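/- For every ρ ∈ (0,1) there is a constant C > 1, depending only on ρ, with the following property: for every positive integer N, every 0 < R < ∞, and every (0,1)-form f of class C¹ on B_N(R) ⊆ ℂ^N (l¹ norm) which is ∂̄-closed and satisfies |f|₀ < ∞, there exists a continuously (real Fréchet) differentiable function u on B_N(ρR) with ∂̄u = f there and |u(z)| ≤ R·C^{#z}·|f|₀ for all z ∈ B_N(ρR). -/

import Mathlib

open Set
open scoped ENNReal NNReal

noncomputable section

/-- `l¹`: the space of absolutely summable sequences of complex numbers. -/
abbrev L1 : Type := lp (fun _ : ℕ => ℂ) 1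

/-- `ℂ^N` equipped with the `l¹` norm. -/
abbrev EN (N : ℕ) : Type := PiLp 1 (fun _ : Fin N => ℂ)

/-- The `(0,1)`-part of the real Fréchet derivative of `u` at `z`, applied to `ξ`:
`∂̄u(z)(ξ) = (Du(z)(ξ) + i·Du(z)(iξ))/2`. -/
noncomputable def dbar {V : Type*} [NormedAddCommGroup V] [NormedSpace ℂ V]
    (u : V → ℂ) (z ξ : V) : ℂ :=
  (fderiv ℝ u z ξ + Complex.I * fderiv ℝ u z (Complex.I • ξ)) / 2

/-- `f` is a `(0,1)`-form of class `C^m` on `Ω`: each `f z` is (continuous) conjugate-linear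
and `(z,ξ) ↦ f z ξ` is `m` times continuously differentiable in the real sense on `Ω × V`. -/
def IsForm01 {V : Type*} [NormedAddCommGroup V] [NormedSpace ℂ V]
    (m : ℕ) (Ω : Set V) (f : V → V → ℂ) : Prop :=
  (∀ z ∈ Ω, ∀ ξ η : V, f z (ξ + η) = f z ξ + f z η) ∧
  (∀ z ∈ Ω, ∀ (a : ℂ) (ξ : V), f z (a • ξ) = (starRingEnd ℂ) a * f z ξ) ∧
  ContDiffOn ℝ m (fun p : V × V => f p.1 p.2) (Ω ×ˢ (univ : Set V))

/-- A `(0,1)`-form `f` is `∂̄`-closed on `Ω`. -/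
def DbarClosed {V : Type*} [NormedAddCommGroup V] [NormedSpace ℂ V]
    (Ω : Set V) (f : V → V → ℂ) : Prop :=
  ∀ z ∈ Ω, ∀ ξ η : V, dbar (fun w => f w ξ) z η = dbar (fun w => f w η) z ξ

/-- The set of values `‖f z ξ‖`, `z ∈ A`, `‖ξ‖ ≤ 1`; its sup is `|f|_{0,A}`. -/
def formSet0 {V : Type*} [NormedAddCommGroup V]
    (f : V → V → ℂ) (A : Set V) : Set ℝ :=
  {x | ∃ z ∈ A, ∃ ξ : V, ‖ξ‖ ≤ 1 ∧ x = ‖f z ξ‖}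

/-- The set of difference quotients `‖f z ξ - f w ξ‖/‖z-w‖`; its sup is `|f|_{1,A}`. -/
def formSet1 {V : Type*} [NormedAddCommGroup V]
    (f : V → V → ℂ) (A : Set V) : Set ℝ :=
  {x | ∃ z ∈ A, ∃ w ∈ A, z ≠ w ∧ ∃ ξ : V, ‖ξ‖ ≤ 1 ∧ x = ‖f z ξ - f w ξ‖ / ‖z - w‖}

/-- `|f|_{0,A}`. -/
noncomputable def formNorm0 {V : Type*} [NormedAddCommGroup V]
    (f : V → V → ℂ) (A : Set V) : ℝ := sSup (formSet0 f A)

/-- `|f|_{1,A}`. -/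
noncomputable def formNorm1 {V : Type*} [NormedAddCommGroup V]
    (f : V → V → ℂ) (A : Set V) : ℝ := sSup (formSet1 f A)

/-- `f` is Lipschitz continuous on `A`: `|f|_{0,A} < ∞` and `|f|_{1,A} < ∞`. -/
def LipschitzForm {V : Type*} [NormedAddCommGroup V]
    (f : V → V → ℂ) (A : Set V) : Prop :=
  BddAbove (formSet0 f A) ∧ BddAbove (formSet1 f A)

/-- `‖k‖ = ∑_ν k_ν` for a multiindex `k`. -/
def knormN (k : ℕ →₀ ℕ) : ℕ := k.sum fun _ m => m

/-- `k^k = ∏_ν k_ν^{k_ν}` (with `0^0 = 1`). -/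
noncomputable def kk (k : ℕ →₀ ℕ) : ℝ := ∏ ν ∈ k.support, (k ν : ℝ) ^ k ν

/-- `‖k‖^{‖k‖}` (with `0^0 = 1`). -/
noncomputable def nn (k : ℕ →₀ ℕ) : ℝ := ((knormN k : ℝ)) ^ knormN k

/-- The monomial `z^k = ∏_ν z_ν^{k_ν}` (with `0^0 = 1`). -/
noncomputable def monom (k : ℕ →₀ ℕ) (z : ℕ → ℂ) : ℂ := ∏ ν ∈ k.support, z ν ^ k ν

/-- The term of the series defining `Δ(q,z)` corresponding to the multiindex `k`:
`(‖k‖^{‖k‖}/k^k)·|q|^{#k}·|z^k|`. -/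
noncomputable def DeltaTerm (q : ℂ) (z : ℕ → ℂ) (k : ℕ →₀ ℕ) : ℝ :=
  (nn k / kk k) * ‖q‖ ^ k.support.card * ∏ ν ∈ k.support, ‖z ν‖ ^ k ν

/-- `Δ(q,z) = ∑_k (‖k‖^{‖k‖}/k^k)·|q|^{#k}·|z^k|`. -/
noncomputable def Delta (q : ℂ) (z : ℕ → ℂ) : ℝ := ∑' k, DeltaTerm q z k


section partA
variable {V W : Type*} [NormedAddCommGroup V] [NormedSpace ℂ V]
  [NormedAddCommGroup W] [NormedSpace ℂ W]

lemma dbar_comp (L : V →L[ℂ] W) (u : W → ℂ) (z ξ : V) (hu : DifferentiableAt ℝ u (L z)) :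
    dbar (fun w => u (L w)) z ξ = dbar u (L z) (L ξ) := by
  have h : HasFDerivAt (fun w => u (L w)) ((fderiv ℝ u (L z)).comp (L.restrictScalars ℝ)) z :=
    HasFDerivAt.comp z hu.hasFDerivAt (L.restrictScalars ℝ).hasFDerivAt
  simp [dbar, h.fderiv]

lemma dbar_sub (u v : V → ℂ) (z ξ : V) (hu : DifferentiableAt ℝ u z)
    (hv : DifferentiableAt ℝ v z) :
    dbar (fun w => u w - v w) z ξ = dbar u z ξ - dbar v z ξ := by
  simp only [dbar, fderiv_fun_sub hu hv, _root_.sub_apply]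
  ring

lemma dbar_add (u v : V → ℂ) (z ξ : V) (hu : DifferentiableAt ℝ u z)
    (hv : DifferentiableAt ℝ v z) :
    dbar (fun w => u w + v w) z ξ = dbar u z ξ + dbar v z ξ := by
  simp only [dbar, fderiv_fun_add hu hv, _root_.add_apply]
  ring

lemma dbar_mul (u v : V → ℂ) (z ξ : V) (hu : DifferentiableAt ℝ u z)
    (hv : DifferentiableAt ℝ v z) :
    dbar (fun w => u w * v w) z ξ = dbar u z ξ * v z + u z * dbar v z ξ := by
  simp only [dbar, fderiv_fun_mul hu hv, _root_.add_apply,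
    _root_.smul_apply, smul_eq_mul]
  ring

lemma dbar_const_mul (a : ℂ) (v : V → ℂ) (z ξ : V) (hv : DifferentiableAt ℝ v z) :
    dbar (fun w => a * v w) z ξ = a * dbar v z ξ := by
  simp only [dbar, fderiv_const_mul hv, _root_.smul_apply, smul_eq_mul]
  ring

lemma dbar_sum {ι : Type*} (s : Finset ι) (u : ι → V → ℂ) (z ξ : V)
    (hu : ∀ i ∈ s, DifferentiableAt ℝ (u i) z) :
    dbar (fun w => ∑ i ∈ s, u i w) z ξ = ∑ i ∈ s, dbar (u i) z ξ := by
  simp only [dbar, fderiv_fun_sum hu, _root_.sum_apply, Finset.mul_sum,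
    ← Finset.sum_add_distrib, Finset.sum_div]

lemma dbar_congr {u v : V → ℂ} {z : V} (h : u =ᶠ[nhds z] v) (ξ : V) :
    dbar u z ξ = dbar v z ξ := by
  simp [dbar, h.fderiv_eq]

lemma dbar_dir_add (u : V → ℂ) (z ξ η : V) :
    dbar u z (ξ + η) = dbar u z ξ + dbar u z η := by
  simp only [dbar, smul_add, map_add]; ring

lemma dbar_dir_smul (u : V → ℂ) (z ξ : V) (a : ℂ) :
    dbar u z (a • ξ) = (starRingEnd ℂ) a * dbar u z ξ := by
  have h1 : a • ξ = (a.re : ℝ) • ξ + (a.im : ℝ) • (Complex.I • ξ) := by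
    conv_lhs => rw [← Complex.re_add_im a]
    rw [add_smul, mul_smul]
    simp
  have h2 : Complex.I • a • ξ = (a.re : ℝ) • (Complex.I • ξ) - (a.im : ℝ) • ξ := by
    conv_lhs => rw [← Complex.re_add_im a]
    rw [add_smul, mul_smul, smul_add, smul_comm Complex.I ((a.im:ℂ)), smul_smul Complex.I Complex.I]
    rw [smul_comm Complex.I ((a.re:ℂ))]
    simp [sub_eq_add_neg]
  rw [dbar, h2, h1]
  simp only [map_add, map_sub, map_smul, Complex.real_smul]
  have h3 : (starRingEnd ℂ) a = a.re - a.im * Complex.I := by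
    apply Complex.ext <;> simp
  rw [h3, dbar]
  linear_combination ((a.im:ℂ) * fderiv ℝ u z (Complex.I • ξ) / 2 : ℂ) * Complex.I_sq

lemma dbar_of_complex {u : V → ℂ} {z : V} (h : DifferentiableAt ℂ u z) (ξ : V) :
    dbar u z ξ = 0 := by
  have h1 := (h.hasFDerivAt.restrictScalars ℝ).fderiv
  simp only [dbar, h1]
  simp
  linear_combination (fderiv ℂ u z ξ) * Complex.I_sq

lemma complex_of_dbar {u : V → ℂ} {z : V} (h : DifferentiableAt ℝ u z)
    (h0 : ∀ ξ, dbar u z ξ = 0) : DifferentiableAt ℂ u z := by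
  have hI : ∀ ξ, fderiv ℝ u z (Complex.I • ξ) = Complex.I * fderiv ℝ u z ξ := by
    intro ξ
    have := h0 ξ
    simp only [dbar] at this
    linear_combination (-2 * Complex.I) * this + (fderiv ℝ u z (Complex.I • ξ)) * Complex.I_sq
  let L : V →L[ℂ] ℂ :=
    { toFun := fderiv ℝ u z
      map_add' := map_add _
      map_smul' := by
        intro a ξ
        have h1 : a • ξ = (a.re : ℝ) • ξ + (a.im : ℝ) • (Complex.I • ξ) := by
          conv_lhs => rw [← Complex.re_add_im a]
          rw [add_smul, mul_smul]
          simp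
        rw [h1, map_add, map_smul, map_smul, hI]
        simp only [RingHom.id_apply, smul_eq_mul, Complex.real_smul]
        linear_combination (fderiv ℝ u z ξ) * Complex.re_add_im a
      cont := (fderiv ℝ u z).continuous }
  exact (hasFDerivAt_of_restrictScalars ℝ (f' := L) h.hasFDerivAt
    (by ext; rfl)).differentiableAt

end partA

section partA2
variable {ι : Type*} [Fintype ι] [DecidableEq ι]

/-- partial `∂̄_j`. -/
def db (j : ι) (u : (ι → ℂ) → ℂ) (z : ι → ℂ) : ℂ := dbar u z (Pi.single j 1)

lemma dbar_eq_sum (u : (ι → ℂ) → ℂ) (z ξ : ι → ℂ) :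
    dbar u z ξ = ∑ j, (starRingEnd ℂ) (ξ j) * db j u z := by
  have h1 : ξ = ∑ j, ξ j • (Pi.single j (1:ℂ) : ι → ℂ) := by
    ext i
    simp [Finset.sum_apply, Pi.single_apply]
  let φ : (ι → ℂ) →+ ℂ := ⟨⟨dbar u z, by simp [dbar]⟩, dbar_dir_add u z⟩
  have h2 : dbar u z ξ = φ ξ := rfl
  rw [h2]
  conv_lhs => rw [h1]
  rw [map_sum]
  refine Finset.sum_congr rfl fun j _ => ?_
  exact dbar_dir_smul u z _ _

/-- open polydisc -/
def PD {ι : Type*} (t : ι → ℝ) : Set (ι → ℂ) := {z | ∀ j, ‖z j‖ < t j}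

lemma isOpen_PD {ι : Type*} [Fintype ι] (t : ι → ℝ) : IsOpen (PD t) := by
  simp only [PD, ofPred_forall]
  exact isOpen_iInter_of_finite fun j => isOpen_lt (by fun_prop) (by fun_prop)

end partA2


open MeasureTheory in
lemma locInt_inv : LocallyIntegrable (fun ζ : ℂ => ζ⁻¹) volume := by
  rw [locallyIntegrable_iff]
  intro K hK
  obtain ⟨r, hr⟩ := hK.isBounded.subset_ball 0
  refine IntegrableOn.mono_set ?_ hr
  have h1 : Integrable (fun ζ : ℂ => (fun y : ℝ => (Iio r).indicator (fun y => y⁻¹) y) ‖ζ‖)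
      volume := by
    rw [integrable_fun_norm_addHaar]
    rw [Complex.finrank_real_complex]
    have h2 : IntegrableOn ((Iio r).indicator (fun _ => (1:ℝ))) (Ioi (0:ℝ)) := by
      rw [IntegrableOn, integrable_indicator_iff measurableSet_Iio, IntegrableOn,
        Measure.restrict_restrict measurableSet_Iio]
      refine (integrable_const_iff).2 (Or.inr ⟨?_⟩)
      simp [Iio_inter_Ioi]
    refine h2.congr_fun ?_ measurableSet_Ioi
    intro y hy
    have hy' : (0:ℝ) < y := hy
    by_cases h : y < r
    · simp [indicator, h, hy'.ne']
    · simp [indicator, h]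
  rw [IntegrableOn, ← integrable_norm_iff (by fun_prop)]
  have h3 : IntegrableOn (fun ζ : ℂ => (fun y : ℝ => (Iio r).indicator (fun y => y⁻¹) y) ‖ζ‖)
      (Metric.ball 0 r) volume := h1.integrableOn
  refine h3.congr_fun ?_ Metric.isOpen_ball.measurableSet
  intro y hy
  have : ‖y‖ < r := by simpa using hy
  simp [indicator, this]

open MeasureTheory in
lemma polar_integrable (H : ℝ → ℝ → ℂ) (hH : Continuous (fun p : ℝ × ℝ => H p.1 p.2)) (B : ℝ)
    (hB : ∀ r θ, B < r → H r θ = 0) :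
    IntegrableOn (fun p : ℝ × ℝ => H p.1 p.2) (Ioi (0:ℝ) ×ˢ Ioo (-Real.pi) Real.pi) := by
  have h1 : IntegrableOn (fun p : ℝ × ℝ => H p.1 p.2)
      (Icc (0:ℝ) B ×ˢ Icc (-Real.pi) Real.pi) :=
    hH.continuousOn.integrableOn_compact (isCompact_Icc.prod isCompact_Icc)
  refine IntegrableOn.of_forall_sdiff_eq_zero h1
    (measurableSet_Ioi.prod measurableSet_Ioo) ?_
  rintro ⟨r, θ⟩ ⟨⟨h2, h3⟩, h4⟩
  apply hB
  by_contra h5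
  exact h4 ⟨⟨(mem_Ioi.1 h2).le, not_lt.1 h5⟩, Ioo_subset_Icc_self h3⟩

open MeasureTheory in
lemma pompeiu (g : ℂ → ℂ) (hg : ContDiff ℝ 1 g) (hc : HasCompactSupport g) (w : ℂ) :
    ∫ ζ : ℂ, ζ⁻¹ * dbar g (w - ζ) 1 = Real.pi * g w := by
  let e : ℝ → ℂ := fun θ => Complex.exp (θ * Complex.I)
  have he : Continuous e := by fun_prop
  have hne : ∀ θ, ‖e θ‖ = 1 := fun θ => Complex.norm_exp_ofReal_mul_I θ
  have hDg : Continuous (fderiv ℝ g) := hg.continuous_fderiv (by norm_num)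
  obtain ⟨B, hB⟩ : ∃ B : ℝ, ∀ z, B ≤ ‖z‖ → g z = 0 := by
    obtain ⟨r, hr⟩ := hc.isCompact.isBounded.subset_ball 0
    refine ⟨r, fun z hz => ?_⟩
    by_contra h
    have := hr (subset_tsupport _ h)
    simp at this
    linarith
  have hB' : ∀ z, B < ‖z‖ → fderiv ℝ g z = 0 := by
    intro z hz
    have : g =ᶠ[nhds z] fun _ => 0 := by
      filter_upwards [(isOpen_lt continuous_const continuous_norm).mem_nhds hz] with y hy
      exact hB y (le_of_lt hy)
    rw [this.fderiv_eq]; simp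
  have hbig : ∀ r θ, ‖w‖ + B < r → B < ‖w - r * e θ‖ := by
    intro r θ h
    have h1 : ‖(r:ℂ) * e θ‖ = |r| := by simp [hne]
    have h2 := norm_sub_norm_le ((r:ℂ) * e θ) w
    rw [norm_sub_rev] at h2
    have := le_abs_self r
    linarith
  let H1 : ℝ → ℝ → ℂ := fun r θ => fderiv ℝ g (w - r * e θ) (e θ)
  let H2 : ℝ → ℝ → ℂ := fun r θ => fderiv ℝ g (w - r * e θ) (Complex.I * e θ)
  have hH1c : Continuous (fun p : ℝ × ℝ => H1 p.1 p.2) := by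
    apply Continuous.clm_apply
    · apply hDg.comp; fun_prop
    · fun_prop
  have hH2c : Continuous (fun p : ℝ × ℝ => H2 p.1 p.2) := by
    apply Continuous.clm_apply
    · apply hDg.comp; fun_prop
    · fun_prop
  have hI1 := polar_integrable H1 hH1c (‖w‖ + B) (fun r θ h => by
    simp only [H1]; rw [hB' _ (hbig r θ h)]; simp)
  have hI2 := polar_integrable H2 hH2c (‖w‖ + B) (fun r θ h => by
    simp only [H2]; rw [hB' _ (hbig r θ h)]; simp)
  rw [← Complex.integral_comp_polarCoord_symm]
  have htarget : polarCoord.target = Ioi (0:ℝ) ×ˢ Ioo (-Real.pi) Real.pi := rfl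
  rw [htarget]
  have hcongr : ∀ p ∈ Ioi (0:ℝ) ×ˢ Ioo (-Real.pi) Real.pi,
      p.1 • ((Complex.polarCoord.symm p)⁻¹ * dbar g (w - Complex.polarCoord.symm p) 1)
      = (1/2 : ℂ) * H1 p.1 p.2 + (Complex.I / 2) * H2 p.1 p.2 := by
    rintro ⟨r, θ⟩ ⟨hr, -⟩
    have hr' : (r:ℂ) ≠ 0 := by
      have : (0:ℝ) < r := hr
      exact_mod_cast this.ne'
    have h1 : Complex.polarCoord.symm (r, θ) = r * e θ := by
      rw [Complex.polarCoord_symm_apply]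
      simp only [e]
      rw [Complex.exp_mul_I]
      push_cast; ring
    rw [h1]
    have h2 := dbar_dir_smul g (w - r * e θ) 1 (e θ)
    have h3 : (starRingEnd ℂ) (e θ) = (e θ)⁻¹ := by
      rw [Complex.inv_def, Complex.normSq_eq_norm_sq, hne]; simp
    rw [h3] at h2
    have h4 : dbar g (w - r * e θ) (e θ • 1) = (H1 r θ + Complex.I * H2 r θ) / 2 := by
      simp [dbar, H1, H2]
    have h5 : e θ ≠ 0 := Complex.exp_ne_zero _
    simp only [Complex.real_smul]
    rw [mul_inv, mul_assoc, ← h2, h4]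
    field_simp
  rw [setIntegral_congr_fun (measurableSet_Ioi.prod measurableSet_Ioo) hcongr]
  rw [integral_add (hI1.const_mul _) (hI2.const_mul _), integral_const_mul, integral_const_mul]
  have e2 : ∫ p in Ioi (0:ℝ) ×ˢ Ioo (-Real.pi) Real.pi, H2 p.1 p.2 = 0 := by
    rw [Measure.volume_eq_prod, setIntegral_prod _ (by rwa [← Measure.volume_eq_prod])]
    refine setIntegral_eq_zero_of_forall_eq_zero fun r hr => ?_
    have hr0 : (r:ℂ) ≠ 0 := by
      have : (0:ℝ) < r := hr
      exact_mod_cast this.ne'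
    rw [← integral_Ioc_eq_integral_Ioo, ← intervalIntegral.integral_of_le (by
      linarith [Real.pi_pos])]
    have hd : ∀ θ ∈ uIcc (-Real.pi) Real.pi,
        HasDerivAt (fun θ : ℝ => -(r:ℂ)⁻¹ * g (w - r * e θ)) (H2 r θ) θ := by
      intro θ _
      have h1 : HasDerivAt (fun θ : ℝ => w - r * e θ) (- (r * (e θ * Complex.I))) θ := by
        have : HasDerivAt e (e θ * (1 * Complex.I)) θ :=
          HasDerivAt.cexp ((Complex.ofRealCLM.hasDerivAt (x := θ)).mul_const Complex.I)
        simp only [one_mul] at this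
        simpa using (this.const_mul (r:ℂ)).const_sub w
      have h2 := ((hg.differentiable (by norm_num) (w - r * e θ)).hasFDerivAt).comp_hasDerivAt θ h1
      have h3 := h2.const_mul (-(r:ℂ)⁻¹)
      refine h3.congr_deriv ?_
      have : -((r:ℂ) * (e θ * Complex.I)) = (-r : ℝ) • (Complex.I * e θ) := by
        rw [Complex.real_smul]; push_cast; ring
      rw [this, map_smul]
      simp only [H2, Complex.real_smul]
      push_cast
      field_simp
    rw [intervalIntegral.integral_eq_sub_of_hasDerivAt hd]
    · have : e Real.pi = e (-Real.pi) := by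
        simp only [e]
        push_cast
        rw [Complex.exp_pi_mul_I, neg_mul, Complex.exp_neg, Complex.exp_pi_mul_I]; norm_num
      rw [this]; simp
    · exact (hH2c.comp (by fun_prop : Continuous fun θ : ℝ => (r, θ))).intervalIntegrable _ _
  have e1 : ∫ p in Ioi (0:ℝ) ×ˢ Ioo (-Real.pi) Real.pi, H1 p.1 p.2 = 2 * Real.pi * g w := by
    rw [Measure.volume_eq_prod, ← setIntegral_prod_swap,
      setIntegral_prod _ (by
        rw [← Measure.volume_eq_prod] at *
        have := hI1.swap
        exact this)]
    have : ∀ θ ∈ Ioo (-Real.pi) Real.pi,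
        ∫ r in Ioi (0:ℝ), H1 (Prod.swap (θ, r)).1 (Prod.swap (θ, r)).2 = g w := by
      intro θ _
      have hcd : ContDiff ℝ 1 (fun r : ℝ => g (w - r * e θ)) := by
        apply hg.comp
        have : ContDiff ℝ 1 (fun r : ℝ => (r : ℂ)) := Complex.ofRealCLM.contDiff
        fun_prop
      have hcs : HasCompactSupport (fun r : ℝ => g (w - r * e θ)) := by
        refine HasCompactSupport.of_support_subset_isCompact
          (isCompact_Icc (a := -(‖w‖ + B)) (b := ‖w‖ + B)) ?_
        intro r hr
        by_contra h
        apply hr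
        apply hB
        have h1 : ‖(r:ℂ) * e θ‖ = |r| := by simp [hne]
        have h2 := norm_sub_norm_le ((r:ℂ) * e θ) w
        rw [norm_sub_rev] at h2
        have : ‖w‖ + B < |r| := by
          by_contra h3
          exact h (abs_le.1 (not_lt.1 h3))
        linarith
      have h1 := HasCompactSupport.integral_Ioi_deriv_eq hcd hcs 0
      have h2 : ∀ r : ℝ, deriv (fun r : ℝ => g (w - r * e θ)) r = - H1 r θ := by
        intro r
        have h1 : HasDerivAt (fun r : ℝ => w - r * e θ) (- e θ) r := by
          simpa using ((Complex.ofRealCLM.hasDerivAt (x := r)).mul_const (e θ)).const_sub w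
        have h2 := ((hg.differentiable (by norm_num) (w - r * e θ)).hasFDerivAt).comp_hasDerivAt r h1
        have h3 := h2.deriv
        rw [Function.comp_def] at h3
        rw [h3]; simp [H1]
      simp only [h2, integral_neg] at h1
      simpa using h1
    rw [setIntegral_congr_fun measurableSet_Ioo this]
    simp
    left
    have := Real.pi_pos
    rw [max_eq_left (by linarith)]; push_cast; ring
  rw [e1, e2]; ring


lemma dbar_comp_hasFDerivAt {V W : Type*} [NormedAddCommGroup V] [NormedSpace ℂ V]
    [NormedAddCommGroup W] [NormedSpace ℂ W] {h : V → W} {L : V →L[ℂ] W} {z : V}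
    (hh : HasFDerivAt h L z) (u : W → ℂ) (ξ : V) (hu : DifferentiableAt ℝ u (h z)) :
    dbar (fun w => u (h w)) z ξ = dbar u (h z) (L ξ) := by
  have h : HasFDerivAt (fun w => u (h w)) ((fderiv ℝ u (h z)).comp (L.restrictScalars ℝ)) z :=
    HasFDerivAt.comp z hu.hasFDerivAt (hh.restrictScalars ℝ)
  simp [dbar, h.fderiv]

lemma dbar_one_of_dbar_dir {φ : ℂ → ℂ} (w η : ℂ) :
    dbar φ w η = (starRingEnd ℂ) η * dbar φ w 1 := by
  have := dbar_dir_smul φ w 1 η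
  simpa using this

section partC
variable {ι : Type} [Fintype ι] [DecidableEq ι]

/-- one-variable Cauchy transform in the variable `k` -/
def CT (k : ι) (φ : ℂ → ℂ) (F : (ι → ℂ) → ℂ) (z : ι → ℂ) : ℂ :=
  (Real.pi : ℂ)⁻¹ * ∫ ζ : ℂ, ζ⁻¹ * (φ (z k - ζ) * F (Function.update z k (z k - ζ)))

/-- the update map as a linear map -/
def updL (k : ι) : ((ι → ℂ) × ℂ) →L[ℂ] (ι → ℂ) :=
  ContinuousLinearMap.pi fun i =>
    if i = k then ContinuousLinearMap.snd ℂ (ι → ℂ) ℂ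
    else (ContinuousLinearMap.proj i).comp (ContinuousLinearMap.fst ℂ (ι → ℂ) ℂ)

lemma updL_apply (k : ι) (z : ι → ℂ) (w : ℂ) : updL k (z, w) = Function.update z k w := by
  ext i
  by_cases h : i = k
  · subst h; simp [updL]
  · simp [updL, h]

/-- the auxiliary function of parameters -/
def gg (k : ι) (φ : ℂ → ℂ) (F : (ι → ℂ) → ℂ) (z : ι → ℂ) (w : ℂ) : ℂ :=
  φ w * F (Function.update z k w)

/-- domain with free `k` variable -/
def Om (k : ι) (t : ι → ℝ) : Set (ι → ℂ) := {z | ∀ j, j ≠ k → ‖z j‖ < t j}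

lemma isOpen_Om (k : ι) (t : ι → ℝ) : IsOpen (Om k t) := by
  simp only [Om, ofPred_forall]
  refine isOpen_iInter_of_finite fun j => ?_
  by_cases h : j = k
  · simp [h]
  · simp only [ne_eq, h, not_false_eq_true, iInter_true]
    exact isOpen_lt (by fun_prop) (by fun_prop)

lemma upd_mem_PD {k : ι} {t : ι → ℝ} {z : ι → ℂ} (hz : z ∈ Om k t) {w : ℂ} (hw : ‖w‖ < t k) :
    Function.update z k w ∈ PD t := by
  intro j
  by_cases h : j = k
  · subst h; simpa using hw
  · simpa [h] using hz j h

variable (k : ι) (t : ι → ℝ) (σ : ℝ) (φ : ℂ → ℂ) (F : (ι → ℂ) → ℂ)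

lemma phi_ev_zero (hφ0 : ∀ w, σ < ‖w‖ → φ w = 0) {w : ℂ} (hw : σ < ‖w‖) :
    φ =ᶠ[nhds w] fun _ => 0 := by
  filter_upwards [(isOpen_lt continuous_const continuous_norm).mem_nhds hw] with y hy
  exact hφ0 y hy

lemma phi_dbar_zero (hφ0 : ∀ w, σ < ‖w‖ → φ w = 0) {w : ℂ} (hw : σ < ‖w‖) (η : ℂ) :
    dbar φ w η = 0 := by
  rw [dbar_congr (phi_ev_zero σ φ hφ0 hw)]; simp [dbar]

lemma gg_ev_zero (hφ0 : ∀ w, σ < ‖w‖ → φ w = 0) {z : ι → ℂ} {w : ℂ} (hw : σ < ‖w‖) :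
    (fun q : (ι → ℂ) × ℂ => gg k φ F q.1 q.2) =ᶠ[nhds (z, w)] fun _ => 0 := by
  filter_upwards [(isOpen_lt continuous_const (continuous_norm.comp continuous_snd)).mem_nhds
    (show σ < ‖(z,w).2‖ from hw)] with y hy
  simp [gg, hφ0 y.2 hy]

lemma gg_contDiffOn (hσ : σ < t k) (hφ : ContDiff ℝ 1 φ) (hφ0 : ∀ w, σ < ‖w‖ → φ w = 0)
    (hF : ContDiffOn ℝ 1 F (PD t)) :
    ContDiffOn ℝ 1 (fun q : (ι → ℂ) × ℂ => gg k φ F q.1 q.2) (Om k t ×ˢ univ) := by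
  rintro ⟨z, w⟩ ⟨hz, -⟩
  apply ContDiffAt.contDiffWithinAt
  by_cases hw : ‖w‖ < t k
  · have h1 : ContDiffAt ℝ 1 F (updL k (z, w)) := by
      rw [updL_apply]
      exact hF.contDiffAt ((isOpen_PD t).mem_nhds (upd_mem_PD hz hw))
    have h2 : ContDiffAt ℝ 1 (fun q : (ι → ℂ) × ℂ => F (updL k q)) (z, w) :=
      ContDiffAt.comp (z, w) h1 ((updL k).restrictScalars ℝ).contDiff.contDiffAt
    have h3 : ContDiffAt ℝ 1 (fun q : (ι → ℂ) × ℂ => φ q.2) (z, w) :=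
      (hφ.comp contDiff_snd).contDiffAt
    refine (h3.mul h2).congr_of_eventuallyEq ?_
    filter_upwards with q
    simp [gg, ← updL_apply]
  · exact (contDiffAt_const (c := (0:ℂ))).congr_of_eventuallyEq
      (gg_ev_zero k σ φ F hφ0 (lt_of_lt_of_le hσ (not_lt.1 hw)))

lemma gg_dbar (hσ : σ < t k) (hφ : ContDiff ℝ 1 φ) (hφ0 : ∀ w, σ < ‖w‖ → φ w = 0)
    (hF : ContDiffOn ℝ 1 F (PD t)) {z : ι → ℂ} (hz : z ∈ Om k t) (w : ℂ) (ξ : ι → ℂ) (η : ℂ) :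
    dbar (fun q : (ι → ℂ) × ℂ => gg k φ F q.1 q.2) (z, w) (ξ, η) =
      dbar φ w η * F (Function.update z k w) +
      φ w * dbar F (Function.update z k w) (Function.update ξ k η) := by
  by_cases hw : ‖w‖ < t k
  · have h1 : DifferentiableAt ℝ F (updL k (z, w)) := by
      rw [updL_apply]
      exact (hF.contDiffAt ((isOpen_PD t).mem_nhds (upd_mem_PD hz hw))).differentiableAt
        (by norm_num)
    have h2 : DifferentiableAt ℝ (fun q : (ι → ℂ) × ℂ => F (updL k q)) (z, w) :=
      DifferentiableAt.comp (z, w) h1 ((updL k).restrictScalars ℝ).differentiableAt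
    have h3' : DifferentiableAt ℝ φ w := hφ.differentiable (by norm_num) w
    have h3 : DifferentiableAt ℝ (fun q : (ι → ℂ) × ℂ => φ q.2) (z, w) :=
      DifferentiableAt.comp (z, w) (g := φ) h3' differentiableAt_snd
    have h4 : (fun q : (ι → ℂ) × ℂ => gg k φ F q.1 q.2) = fun q => φ q.2 * F (updL k q) := by
      ext q; simp [gg, ← updL_apply]
    rw [h4, dbar_mul _ _ _ _ h3 h2, dbar_comp (updL k) F _ _ h1]
    have h5 := dbar_comp (ContinuousLinearMap.snd ℂ (ι → ℂ) ℂ) φ (z, w) (ξ, η) h3'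
    simp only [ContinuousLinearMap.coe_snd'] at h5
    rw [h5, updL_apply, updL_apply]
  · have hw' := (lt_of_lt_of_le hσ (not_lt.1 hw))
    rw [dbar_congr (gg_ev_zero k σ φ F hφ0 hw'), phi_dbar_zero σ φ hφ0 hw', hφ0 w hw']
    simp [dbar]

lemma gg_slice_contDiff (hσ : σ < t k) (hφ : ContDiff ℝ 1 φ) (hφ0 : ∀ w, σ < ‖w‖ → φ w = 0)
    (hF : ContDiffOn ℝ 1 F (PD t)) {z : ι → ℂ} (hz : z ∈ Om k t) :
    ContDiff ℝ 1 (gg k φ F z) := by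
  have h := gg_contDiffOn k t σ φ F hσ hφ hφ0 hF
  have : ContDiff ℝ 1 (fun w : ℂ => (z, w)) := contDiff_prodMk_right z
  exact contDiffOn_univ.1 (h.comp this.contDiffOn (fun w _ => ⟨hz, mem_univ _⟩))

lemma gg_slice_compact (hφ0 : ∀ w, σ < ‖w‖ → φ w = 0) (z : ι → ℂ) :
    HasCompactSupport (gg k φ F z) := by
  refine HasCompactSupport.of_support_subset_isCompact (isCompact_closedBall (0:ℂ) σ) ?_
  intro w hw
  by_contra h
  simp only [Metric.mem_closedBall, dist_zero_right, not_le] at h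
  exact hw (by simp [gg, hφ0 w h])

lemma gg_slice_dbar (hσ : σ < t k) (hφ : ContDiff ℝ 1 φ) (hφ0 : ∀ w, σ < ‖w‖ → φ w = 0)
    (hF : ContDiffOn ℝ 1 F (PD t)) {z : ι → ℂ} (hz : z ∈ Om k t) (w : ℂ) :
    dbar (gg k φ F z) w 1 = dbar φ w 1 * F (Function.update z k w) +
      φ w * db k F (Function.update z k w) := by
  have h := gg_contDiffOn k t σ φ F hσ hφ hφ0 hF
  have h1 : HasFDerivAt (fun w : ℂ => ((z, w) : (ι → ℂ) × ℂ))
      (ContinuousLinearMap.inr ℂ (ι → ℂ) ℂ) w := hasFDerivAt_prodMk_right z w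
  have hd : DifferentiableAt ℝ (fun q : (ι → ℂ) × ℂ => gg k φ F q.1 q.2) (z, w) :=
    (h.contDiffAt (((isOpen_Om k t).prod isOpen_univ).mem_nhds ⟨hz, mem_univ _⟩)).differentiableAt
      (by norm_num)
  have h2 := dbar_comp_hasFDerivAt h1 (fun q : (ι → ℂ) × ℂ => gg k φ F q.1 q.2) 1 hd
  simp only [ContinuousLinearMap.inr_apply] at h2
  rw [gg_dbar k t σ φ F hσ hφ hφ0 hF hz] at h2
  exact h2

open MeasureTheory in
lemma integrable_inv_mul (g : ℂ → ℂ) (hg : Continuous g) (hc : HasCompactSupport g) (w : ℂ) :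
    Integrable (fun ζ : ℂ => ζ⁻¹ * g (w - ζ)) volume :=
  (hc.convolutionExists_right (ContinuousLinearMap.mul ℝ ℂ) locInt_inv hg w).integrable

open MeasureTheory Convolution in
lemma CT_contDiffOn (hσ : σ < t k) (hφ : ContDiff ℝ 1 φ) (hφ0 : ∀ w, σ < ‖w‖ → φ w = 0)
    (hF : ContDiffOn ℝ 1 F (PD t)) : ContDiffOn ℝ 1 (CT k φ F) (Om k t) := by
  have h := contDiffOn_convolution_right_with_param (n := 1) (ContinuousLinearMap.mul ℝ ℂ)
    (g := gg k φ F)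
    (isOpen_Om k t) (isCompact_closedBall (0:ℂ) σ) (fun p x _ hx => by
      simp only [Metric.mem_closedBall, dist_zero_right, not_le] at hx
      simp [gg, hφ0 x hx]) locInt_inv (gg_contDiffOn k t σ φ F hσ hφ hφ0 hF)
  have h2 : ContDiff ℝ 1 (fun z : ι → ℂ => (z, z k)) := by fun_prop
  exact contDiffOn_const.mul (h.comp h2.contDiffOn (fun z hz => ⟨hz, mem_univ _⟩))

open MeasureTheory Convolution in
lemma CT_dbar (hσ : σ < t k) (hφ : ContDiff ℝ 1 φ) (hφ0 : ∀ w, σ < ‖w‖ → φ w = 0)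
    (hF : ContDiffOn ℝ 1 F (PD t)) {z : ι → ℂ} (hz : z ∈ Om k t) (ξ : ι → ℂ) :
    dbar (CT k φ F) z ξ = (Real.pi : ℂ)⁻¹ * ∫ ζ : ℂ, ζ⁻¹ *
      (dbar φ (z k - ζ) (ξ k) * F (Function.update z k (z k - ζ)) +
      φ (z k - ζ) * dbar F (Function.update z k (z k - ζ)) ξ) := by
  have hgC := gg_contDiffOn k t σ φ F hσ hφ hφ0 hF
  set G : (ι → ℂ) × ℂ → ℂ := fun q => gg k φ F q.1 q.2 with hG
  have hsupp : ∀ p, ∀ x, p ∈ Om k t → x ∉ Metric.closedBall (0:ℂ) σ → gg k φ F p x = 0 := by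
    intro p x _ hx
    simp only [Metric.mem_closedBall, dist_zero_right, not_le] at hx
    simp [gg, hφ0 x hx]
  have h := hasFDerivAt_convolution_right_with_param (ContinuousLinearMap.mul ℝ ℂ)
    (g := gg k φ F)
    (isOpen_Om k t) (isCompact_closedBall (0:ℂ) σ) hsupp locInt_inv hgC (z, z k) hz
  have h2 : HasFDerivAt (fun z : ι → ℂ => (z, z k))
      ((ContinuousLinearMap.id ℝ (ι → ℂ)).prod (ContinuousLinearMap.proj k)) z := by
    exact (hasFDerivAt_id z).prodMk (hasFDerivAt_apply k z)
  have h3 := (HasFDerivAt.comp z h h2).const_mul ((Real.pi : ℂ)⁻¹)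
  have hfd : fderiv ℝ (CT k φ F) z = _ := h3.fderiv
  have hcont : Continuous (fun w : ℂ => fderiv ℝ G (z, w)) := by
    have := (hgC.continuousOn_fderiv_of_isOpen ((isOpen_Om k t).prod isOpen_univ) (by norm_num))
    exact this.comp_continuous (by fun_prop) (fun w => ⟨hz, mem_univ _⟩)
  have hcs : HasCompactSupport (fun w : ℂ => fderiv ℝ G (z, w)) := by
    refine HasCompactSupport.of_support_subset_isCompact (isCompact_closedBall (0:ℂ) σ) ?_
    intro w hw
    by_contra h
    simp only [Metric.mem_closedBall, dist_zero_right, not_le] at h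
    apply hw
    show fderiv ℝ G (z, w) = 0
    rw [(gg_ev_zero k σ φ F hφ0 h).fderiv_eq]; simp
  have happ : ∀ ξ : ι → ℂ, fderiv ℝ (CT k φ F) z ξ = (Real.pi : ℂ)⁻¹ *
      ∫ ζ : ℂ, ζ⁻¹ * fderiv ℝ G (z, z k - ζ) (ξ, ξ k) := by
    intro ξ
    rw [hfd]
    simp only [_root_.smul_apply, ContinuousLinearMap.comp_apply, smul_eq_mul]
    congr 1
    have := convolution_precompR_apply (ContinuousLinearMap.mul ℝ ℂ) locInt_inv hcs hcont
      (z k) (ξ, ξ k)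
    refine Eq.trans ?_ (this.trans ?_)
    · rfl
    · rfl
  have hint : ∀ v : (ι → ℂ) × ℂ, Integrable (fun ζ : ℂ => ζ⁻¹ * fderiv ℝ G (z, z k - ζ) v)
      volume := by
    intro v
    refine integrable_inv_mul (fun w => fderiv ℝ G (z, w) v) (by fun_prop) ?_ (z k)
    exact hcs.comp_left (g := fun L => L v) (by simp)
  simp only [dbar] at *
  rw [happ, happ]
  have e : ∀ a b c : ℂ, (a * b + Complex.I * (a * c)) / 2 = a * ((b + Complex.I * c) / 2) := by
    intros; ring
  rw [e, ← integral_const_mul, ← integral_add (hint _) ((hint _).const_mul _),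
    ← integral_div]
  congr 1
  apply integral_congr_ae
  filter_upwards with ζ
  have h5 := gg_dbar k t σ φ F hσ hφ hφ0 hF hz (z k - ζ) ξ (ξ k)
  rw [show Function.update ξ k (ξ k) = ξ by simp] at h5
  simp only [dbar] at h5
  rw [← h5]
  simp only [hG, Prod.smul_mk, Pi.smul_apply]
  ring

lemma CT_db_ne (hσ : σ < t k) (hφ : ContDiff ℝ 1 φ) (hφ0 : ∀ w, σ < ‖w‖ → φ w = 0)
    (hF : ContDiffOn ℝ 1 F (PD t)) {z : ι → ℂ} (hz : z ∈ Om k t) {j : ι} (hj : j ≠ k) :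
    db j (CT k φ F) z = CT k φ (db j F) z := by
  rw [db, CT_dbar k t σ φ F hσ hφ hφ0 hF hz, CT]
  congr 2
  ext ζ
  have : (Pi.single j (1:ℂ) : ι → ℂ) k = 0 := by simp [Pi.single_apply, hj.symm]
  rw [this]
  have h0 : dbar φ (z k - ζ) 0 = 0 := by simp [dbar]
  rw [h0]; simp [db]

lemma CT_db_self (hσ : σ < t k) (hφ : ContDiff ℝ 1 φ) (hφ0 : ∀ w, σ < ‖w‖ → φ w = 0)
    (hF : ContDiffOn ℝ 1 F (PD t)) {z : ι → ℂ} (hz : z ∈ Om k t) :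
    db k (CT k φ F) z = φ (z k) * F z := by
  rw [db, CT_dbar k t σ φ F hσ hφ hφ0 hF hz]
  have h1 := pompeiu (gg k φ F z) (gg_slice_contDiff k t σ φ F hσ hφ hφ0 hF hz)
    (gg_slice_compact k σ φ F hφ0 z) (z k)
  simp only [gg_slice_dbar k t σ φ F hσ hφ hφ0 hF hz] at h1
  simp only [Pi.single_eq_same]
  simp only [db] at h1
  rw [h1]
  have : (Real.pi : ℂ) ≠ 0 := by exact_mod_cast Real.pi_ne_zero
  simp [gg, this]

open MeasureTheory in
lemma CT_by_parts (hσ : σ < t k) (hφ : ContDiff ℝ 2 φ) (hφ0 : ∀ w, σ < ‖w‖ → φ w = 0)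
    (hF : ContDiffOn ℝ 1 F (PD t)) {z : ι → ℂ} (hz : z ∈ Om k t) :
    CT k φ (db k F) z = φ (z k) * F z - CT k (fun w => dbar φ w 1) F z := by
  have hφ1 : ContDiff ℝ 1 φ := hφ.of_le (by norm_num)
  have h1 := pompeiu (gg k φ F z) (gg_slice_contDiff k t σ φ F hσ hφ1 hφ0 hF hz)
    (gg_slice_compact k σ φ F hφ0 z) (z k)
  have hφ'1 : ContDiff ℝ 1 (fun w => dbar φ w 1) := by
    simp only [dbar]
    have : ContDiff ℝ 1 (fderiv ℝ φ) := hφ.fderiv_right (by norm_num)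
    fun_prop
  have hφ'0 : ∀ w, σ < ‖w‖ → (fun w => dbar φ w 1) w = 0 := fun w hw =>
    phi_dbar_zero σ φ hφ0 hw 1
  have hi1 := integrable_inv_mul (gg k (fun w => dbar φ w 1) F z)
    (gg_slice_contDiff k t σ _ F hσ hφ'1 hφ'0 hF hz).continuous
    (gg_slice_compact k σ _ F hφ'0 z) (z k)
  have hi0 : Integrable (fun ζ => ζ⁻¹ * dbar (gg k φ F z) (z k - ζ) 1) volume := by
    refine integrable_inv_mul (fun w => dbar (gg k φ F z) w 1) ?_ ?_ (z k)
    · simp only [dbar]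
      have : Continuous (fderiv ℝ (gg k φ F z)) :=
        (gg_slice_contDiff k t σ φ F hσ hφ1 hφ0 hF hz).continuous_fderiv (by norm_num)
      fun_prop
    · refine HasCompactSupport.of_support_subset_isCompact (isCompact_closedBall (0:ℂ) σ) ?_
      intro w hw
      by_contra h
      simp only [Metric.mem_closedBall, dist_zero_right, not_le] at h
      apply hw
      show dbar (gg k φ F z) w 1 = 0
      rw [gg_slice_dbar k t σ φ F hσ hφ1 hφ0 hF hz, phi_dbar_zero σ φ hφ0 h, hφ0 w h]
      simp
  have h2 : CT k φ (db k F) z = (Real.pi : ℂ)⁻¹ *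
      ∫ ζ : ℂ, (ζ⁻¹ * dbar (gg k φ F z) (z k - ζ) 1 -
        ζ⁻¹ * gg k (fun w => dbar φ w 1) F z (z k - ζ)) := by
    rw [CT]
    congr 2
    ext ζ
    rw [gg_slice_dbar k t σ φ F hσ hφ1 hφ0 hF hz]
    simp only [gg]; ring
  rw [h2, integral_sub hi0 hi1, h1, CT]
  have : (Real.pi : ℂ) ≠ 0 := by exact_mod_cast Real.pi_ne_zero
  rw [mul_sub]
  simp [gg, this]

lemma CT_congr (hσ : σ < t k) (hφ0 : ∀ w, σ < ‖w‖ → φ w = 0) {G : (ι → ℂ) → ℂ}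
    (hFG : ∀ z ∈ PD t, F z = G z) {z : ι → ℂ} (hz : z ∈ Om k t) :
    CT k φ F z = CT k φ G z := by
  rw [CT, CT]
  congr 2
  ext ζ
  by_cases hw : ‖z k - ζ‖ < t k
  · rw [hFG _ (upd_mem_PD hz hw)]
  · rw [hφ0 _ (lt_of_lt_of_le hσ (not_lt.1 hw))]; simp

/-- the constant in the bound for the Cauchy transform -/
def ctI (S : ℝ) : ℝ := Real.pi⁻¹ * ∫ ζ in Metric.closedBall (0:ℂ) (2 * S), ‖ζ⁻¹‖

lemma ctI_nonneg (S : ℝ) : 0 ≤ ctI S := by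
  apply mul_nonneg (by positivity)
  exact MeasureTheory.integral_nonneg (fun _ => norm_nonneg _)

open MeasureTheory in
lemma CT_bound (hσ : σ < t k) (hφ0 : ∀ w, σ < ‖w‖ → φ w = 0) {K M : ℝ}
    (hM0 : 0 ≤ M) (hK0 : 0 ≤ K) (hK : ∀ w, ‖φ w‖ ≤ K) (hM : ∀ z ∈ PD t, ‖F z‖ ≤ M)
    {z : ι → ℂ} (hz : z ∈ PD t) : ‖CT k φ F z‖ ≤ ctI (t k) * (K * M) := by
  have hz' : z ∈ Om k t := fun j _ => hz j
  have h1 : Integrable ((Metric.closedBall (0:ℂ) (2 * t k)).indicator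
      (fun ζ : ℂ => ‖ζ⁻¹‖ * (K * M))) volume := by
    rw [integrable_indicator_iff measurableSet_closedBall]
    exact ((locInt_inv.integrableOn_isCompact (isCompact_closedBall _ _)).norm).mul_const _
  have h2 : ∀ ζ : ℂ, ‖ζ⁻¹ * (φ (z k - ζ) * F (Function.update z k (z k - ζ)))‖ ≤
      (Metric.closedBall (0:ℂ) (2 * t k)).indicator (fun ζ : ℂ => ‖ζ⁻¹‖ * (K * M)) ζ := by
    intro ζ
    by_cases hw : ‖z k - ζ‖ < t k
    · have : ζ ∈ Metric.closedBall (0:ℂ) (2 * t k) := by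
        simp only [Metric.mem_closedBall, dist_zero_right]
        have h3 : ζ = z k - (z k - ζ) := by ring
        have h4 := norm_sub_le (z k) (z k - ζ)
        rw [← h3] at h4
        have := hz k
        linarith
      rw [indicator_of_mem this, norm_mul, norm_mul]
      exact mul_le_mul_of_nonneg_left (mul_le_mul (hK _) (hM _ (upd_mem_PD hz' hw))
        (norm_nonneg _) hK0) (norm_nonneg _)
    · rw [hφ0 _ (lt_of_lt_of_le hσ (not_lt.1 hw))]
      simp only [zero_mul, mul_zero, norm_zero]
      exact indicator_nonneg (fun _ _ => by positivity) _
  have h3 := norm_integral_le_of_norm_le h1 (Filter.Eventually.of_forall h2)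
  rw [integral_indicator measurableSet_closedBall, integral_mul_const] at h3
  rw [CT, norm_mul, ctI, mul_assoc]
  have h4 : ‖((Real.pi:ℂ))⁻¹‖ = Real.pi⁻¹ := by
    rw [norm_inv, Complex.norm_real, Real.norm_of_nonneg Real.pi_pos.le]
  rw [h4]
  exact mul_le_mul_of_nonneg_left h3 (by positivity)

end partC


lemma exists_bump (δ : ℝ) (hδ : 0 < δ) : ∃ (φ : ℂ → ℂ) (K : ℝ), ContDiff ℝ 2 φ ∧ 0 ≤ K ∧
    (∀ w, ‖w‖ < 1 → φ w = 1) ∧ (∀ w, 1 + δ / 2 < ‖w‖ → φ w = 0) ∧ (∀ w, ‖φ w‖ ≤ 1) ∧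
    (∀ w, ‖dbar φ w 1‖ ≤ K) := by
  let b : ContDiffBump (0:ℂ) := ⟨1, 1 + δ / 2, one_pos, by linarith⟩
  have hb : ContDiff ℝ 2 (fun w : ℂ => ((b w : ℝ) : ℂ)) :=
    Complex.ofRealCLM.contDiff.comp b.contDiff
  have h0 : ∀ w : ℂ, 1 + δ / 2 < ‖w‖ → ((b w : ℝ) : ℂ) = 0 := by
    intro w hw
    rw [b.zero_of_le_dist (by simpa using hw.le)]; simp
  have hcont : Continuous (fun w : ℂ => dbar (fun w : ℂ => ((b w : ℝ) : ℂ)) w 1) := by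
    simp only [dbar]
    have : Continuous (fderiv ℝ (fun w : ℂ => ((b w : ℝ) : ℂ))) :=
      hb.continuous_fderiv (by norm_num)
    fun_prop
  have hcs : HasCompactSupport (fun w : ℂ => dbar (fun w : ℂ => ((b w : ℝ) : ℂ)) w 1) := by
    refine HasCompactSupport.of_support_subset_isCompact (isCompact_closedBall (0:ℂ) (1 + δ / 2)) ?_
    intro w hw
    by_contra h
    simp only [Metric.mem_closedBall, dist_zero_right, not_le] at h
    exact hw (phi_dbar_zero (1 + δ / 2) _ h0 h 1)
  obtain ⟨K, hK⟩ := hcont.bounded_above_of_compact_support hcs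
  refine ⟨fun w => ((b w : ℝ) : ℂ), K, hb, (norm_nonneg _).trans (hK 0), ?_, h0, ?_, hK⟩
  · intro w hw
    have : b w = 1 := b.one_of_mem_closedBall (by simpa using hw.le)
    simp [this]
  · intro w
    rw [Complex.norm_real, Real.norm_of_nonneg b.nonneg]
    exact b.le_one

section partC2
variable {ι : Type} [Fintype ι] [DecidableEq ι]

def ts (δ : ℝ) (s : Finset ι) (j : ι) : ℝ := if j ∈ s then 1 + δ else 1

set_option linter.unusedSectionVars false in
lemma PD_ts_subset {δ : ℝ} (hδ : 0 < δ) {s : Finset ι} {k : ι} :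
    PD (ts δ s) ⊆ PD (ts δ (insert k s)) := by
  intro z hz j
  refine lt_of_lt_of_le (hz j) ?_
  unfold ts
  split_ifs with h1 h2 h2
  · exact le_rfl
  · exact absurd (Finset.mem_insert_of_mem h1) h2
  · linarith
  · exact le_rfl

set_option linter.unusedSectionVars false in
lemma PD_sub_Om {t : ι → ℝ} (k : ι) : PD t ⊆ Om k t := fun _ hz j _ => hz j

lemma poly_step (δ : ℝ) (hδ : 0 < δ) (φ : ℂ → ℂ) (K : ℝ) (hφ : ContDiff ℝ 2 φ) (hK0 : 0 ≤ K)
    (hφ1 : ∀ w, ‖w‖ < 1 → φ w = 1) (hφ0 : ∀ w, 1 + δ / 2 < ‖w‖ → φ w = 0)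
    (hφb : ∀ w, ‖φ w‖ ≤ 1) (hφK : ∀ w, ‖dbar φ w 1‖ ≤ K) (A : ℝ) (hA1 : 1 ≤ A)
    (hA : ctI (1 + δ) * (1 + K) ≤ A) (s : Finset ι) :
    ∀ (F : ι → (ι → ℂ) → ℂ) (M : ℝ), 0 ≤ M →
      (∀ j, ContDiffOn ℝ 1 (F j) (PD (ts δ s))) →
      (∀ i j, ∀ z ∈ PD (ts δ s), db i (F j) z = db j (F i) z) →
      (∀ j, j ∉ s → ∀ z ∈ PD (ts δ s), F j z = 0) →
      (∀ j, ∀ z ∈ PD (ts δ s), ‖F j z‖ ≤ M) →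
      ∃ u : (ι → ℂ) → ℂ, ContDiffOn ℝ 1 u (PD fun _ => 1) ∧
        (∀ j, ∀ z ∈ PD (fun _ => 1), db j u z = F j z) ∧
        (∀ z ∈ PD (fun _ => 1), ‖u z‖ ≤ A ^ s.card * M) := by
  induction s using Finset.induction_on with
  | empty =>
    intro F M hM _ _ h0 _
    have e : PD (ts δ (∅ : Finset ι)) = PD (fun _ => 1) := by
      congr 1
    refine ⟨fun _ => 0, contDiffOn_const, ?_, ?_⟩
    · intro j z hz
      rw [h0 j (by simp) z (e ▸ hz)]
      simp [db, dbar]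
    · intro z hz
      simpa using hM
  | insert k s hks ih =>
    intro F M hM hF hcl h0 hb
    set T := ts δ (insert k s) with hT
    have hTk : T k = 1 + δ := by simp [hT, ts]
    have hσ : 1 + δ / 2 < T k := by rw [hTk]; linarith
    have hsub : PD (ts δ s) ⊆ PD T := PD_ts_subset hδ
    have hsk : ∀ z ∈ PD (ts δ s), ‖z k‖ < 1 := by
      intro z hz
      have := hz k
      simpa [ts, hks] using this
    have hφc1 : ContDiff ℝ 1 φ := hφ.of_le (by norm_num)
    set φ' : ℂ → ℂ := fun w => dbar φ w 1 with hφ'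
    have hφ'1 : ContDiff ℝ 1 φ' := by
      simp only [hφ', dbar]
      have : ContDiff ℝ 1 (fderiv ℝ φ) := hφ.fderiv_right (by norm_num)
      fun_prop
    have hφ'0 : ∀ w, 1 + δ / 2 < ‖w‖ → φ' w = 0 := fun w hw => phi_dbar_zero _ φ hφ0 hw 1
    have hφ'z : ∀ w, ‖w‖ < 1 → φ' w = 0 := by
      intro w hw
      have : φ =ᶠ[nhds w] fun _ => 1 := by
        filter_upwards [(isOpen_lt continuous_norm continuous_const).mem_nhds hw] with y hy
        exact hφ1 y hy
      simp only [hφ']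
      rw [dbar_congr this]; simp [dbar]
    have hPO : ∀ z ∈ PD (ts δ s), z ∈ Om k T := fun z hz => PD_sub_Om k (hsub hz)
    set v := CT k φ (F k) with hv
    have hvC : ContDiffOn ℝ 1 v (PD T) :=
      (CT_contDiffOn k T _ φ (F k) hσ hφc1 hφ0 (hF k)).mono (PD_sub_Om k)
    set F' : ι → (ι → ℂ) → ℂ := fun j => if j = k then fun _ => 0 else CT k φ' (F j) with hF'
    have hdiff : ∀ j, ∀ z ∈ PD (ts δ s), db j v z + F' j z = F j z := by
      intro j z hz
      by_cases hj : j = k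
      · subst hj
        simp only [hF', if_true, add_zero]
        rw [hv, CT_db_self j T _ φ (F j) hσ hφc1 hφ0 (hF j) (hPO z hz), hφ1 _ (hsk z hz), one_mul]
      · simp only [hF', hj, if_false]
        rw [hv, CT_db_ne k T _ φ (F k) hσ hφc1 hφ0 (hF k) (hPO z hz) hj,
          CT_congr k T _ φ _ hσ hφ0 (fun y hy => hcl j k y hy) (hPO z hz),
          CT_by_parts k T _ φ (F j) hσ hφ hφ0 (hF j) (hPO z hz), hφ1 _ (hsk z hz)]
        ring
    have hI := ctI_nonneg (1 + δ)
    have hex : ∃ u : (ι → ℂ) → ℂ, ContDiffOn ℝ 1 u (PD fun _ => 1) ∧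
        (∀ j, ∀ z ∈ PD (fun _ => 1), db j u z = F' j z) ∧
        (∀ z ∈ PD (fun _ => 1), ‖u z‖ ≤ A ^ s.card * (ctI (1 + δ) * (K * M))) := by
      refine ih F' (ctI (1 + δ) * (K * M)) (by positivity) ?_ ?_ ?_ ?_
      · intro j
        by_cases hj : j = k
        · simp only [hF', hj, if_true]; exact contDiffOn_const
        · simp only [hF', hj, if_false]
          exact (CT_contDiffOn k T _ φ' (F j) hσ hφ'1 hφ'0 (hF j)).mono hPO
      · have key : ∀ j, j ≠ k → ∀ z ∈ PD (ts δ s), db k (F' j) z = 0 := by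
          intro j hj z hz
          simp only [hF', hj, if_false]
          rw [CT_db_self k T _ φ' (F j) hσ hφ'1 hφ'0 (hF j) (hPO z hz), hφ'z _ (hsk z hz), zero_mul]
        have key0 : ∀ j z, db j (F' k) z = 0 := by
          intro j z
          simp [hF', db, dbar]
        intro i j z hz
        by_cases hj : j = k
        · by_cases hi : i = k
          · rw [hi, hj]
          · rw [hj, key0, key i hi z hz]
        · by_cases hi : i = k
          · rw [hi, key0, key j hj z hz]
          · simp only [hF', hj, hi, if_false]
            rw [CT_db_ne k T _ φ' (F j) hσ hφ'1 hφ'0 (hF j) (hPO z hz) hi,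
              CT_db_ne k T _ φ' (F i) hσ hφ'1 hφ'0 (hF i) (hPO z hz) hj]
            exact CT_congr k T _ φ' _ hσ hφ'0 (fun y hy => hcl i j y hy) (hPO z hz)
      · intro j hj z hz
        by_cases hjk : j = k
        · simp [hF', hjk]
        · simp only [hF', hjk, if_false]
          rw [CT_congr k T _ φ' (F j) hσ hφ'0 (G := fun _ => 0)
            (fun y hy => h0 j (by simp [hjk, hj]) y hy) (hPO z hz)]
          simp [CT]
      · intro j z hz
        by_cases hjk : j = k
        · simp only [hF', hjk, if_true, norm_zero]; positivity
        · simp only [hF', hjk, if_false]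
          have := CT_bound k T _ φ' (F j) hσ hφ'0 hM hK0 hφK (hb j) (hsub hz)
          rwa [hTk] at this
    obtain ⟨u, hu1, hu2, hu3⟩ := hex
    have h1s : PD (fun _ : ι => (1:ℝ)) ⊆ PD (ts δ s) := by
      intro z hz j
      refine lt_of_lt_of_le (hz j) ?_
      unfold ts; split_ifs <;> linarith
    refine ⟨fun z => v z + u z, (hvC.mono (h1s.trans hsub)).add hu1, ?_, ?_⟩
    · intro j z hz
      have hm := (isOpen_PD (fun _ : ι => (1:ℝ))).mem_nhds hz
      have d1 := ((hvC.mono (h1s.trans hsub)).contDiffAt hm).differentiableAt (by norm_num)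
      have d2 := (hu1.contDiffAt hm).differentiableAt (by norm_num)
      have := hu2 j z hz
      rw [db] at this ⊢
      rw [dbar_add _ _ _ _ d1 d2, this]
      exact hdiff j z (h1s hz)
    · intro z hz
      have b1 := CT_bound k T _ φ (F k) hσ hφ0 hM zero_le_one hφb (hb k) (hsub (h1s hz))
      have b2 := hu3 z hz
      rw [hTk] at b1
      rw [Finset.card_insert_of_notMem hks, pow_succ]
      have hAp : 1 ≤ A ^ s.card := one_le_pow₀ hA1
      calc ‖v z + u z‖ ≤ ‖v z‖ + ‖u z‖ := norm_add_le _ _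
        _ ≤ ctI (1 + δ) * (1 * M) + A ^ s.card * (ctI (1 + δ) * (K * M)) := add_le_add b1 b2
        _ ≤ A ^ s.card * (ctI (1 + δ) * M) + A ^ s.card * (ctI (1 + δ) * (K * M)) := by
          have : 1 * (ctI (1 + δ) * M) ≤ A ^ s.card * (ctI (1 + δ) * M) :=
            mul_le_mul_of_nonneg_right hAp (by positivity)
          linarith
        _ = A ^ s.card * ((ctI (1 + δ) * (1 + K)) * M) := by ring
        _ ≤ A ^ s.card * (A * M) := by gcongr
        _ = A ^ s.card * A * M := by ring

end partC2

/-- solution on the unit polydisc -/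
lemma poly_solve (δ : ℝ) (hδ : 0 < δ) : ∃ A : ℝ, 1 ≤ A ∧ ∀ (n : ℕ)
    (F : Fin n → (Fin n → ℂ) → ℂ) (M : ℝ), 0 ≤ M →
      (∀ j, ContDiffOn ℝ 1 (F j) (PD fun _ => 1 + δ)) →
      (∀ i j, ∀ z ∈ PD (fun _ => 1 + δ), db i (F j) z = db j (F i) z) →
      (∀ j, ∀ z ∈ PD (fun _ => 1 + δ), ‖F j z‖ ≤ M) →
      ∃ u : (Fin n → ℂ) → ℂ, ContDiffOn ℝ 1 u (PD fun _ => 1) ∧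
        (∀ j, ∀ z ∈ PD (fun _ => 1), db j u z = F j z) ∧
        (∀ z ∈ PD (fun _ => 1), ‖u z‖ ≤ A ^ n * M) := by
  obtain ⟨φ, K, h1, h2, h3, h4, h5, h6⟩ := exists_bump δ hδ
  refine ⟨max 1 (ctI (1 + δ) * (1 + K)), le_max_left _ _, ?_⟩
  intro n F M hM hF hc hb
  have e : ts δ (Finset.univ : Finset (Fin n)) = fun _ => 1 + δ := by
    ext j; simp [ts]
  have := poly_step δ hδ φ K h1 h2 h3 h4 h5 h6 _ (le_max_left 1 (ctI (1 + δ) * (1 + K)))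
    (le_max_right _ _) (Finset.univ : Finset (Fin n)) F M hM
  rw [e] at this
  simpa using this hF hc (by simp) hb


section partD

/-- Taylor coefficient of order `m` in the first variable -/
def ac {n : ℕ} (m : ℕ) (g : (Fin (n+1) → ℂ) → ℂ) (z' : Fin n → ℂ) : ℂ :=
  ((m.factorial : ℂ))⁻¹ * iteratedDeriv m (fun w : ℂ => g (Fin.cons w z')) 0

lemma hasFDerivAt_cons_right {n : ℕ} (w : ℂ) (z' : Fin n → ℂ) :
    HasFDerivAt (fun y : Fin n → ℂ => (Fin.cons w y : Fin (n+1) → ℂ))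
      (ContinuousLinearMap.pi (Fin.cons (0 : (Fin n → ℂ) →L[ℂ] ℂ)
        fun i => ContinuousLinearMap.proj i)) z' := by
  rw [hasFDerivAt_pi']
  intro i
  refine Fin.cases ?_ (fun i => ?_) i
  · simpa using hasFDerivAt_const w z'
  · simpa using hasFDerivAt_apply i z'

lemma differentiable_cons_left {n : ℕ} (z' : Fin n → ℂ) :
    Differentiable ℂ (fun w : ℂ => (Fin.cons w z' : Fin (n+1) → ℂ)) := by
  rw [differentiable_pi]
  intro i
  refine Fin.cases ?_ (fun i => ?_) i
  · simp
  · simp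

lemma cons_mem_PD {n : ℕ} {t : Fin (n+1) → ℝ} {z' : Fin n → ℂ} (hz : z' ∈ PD (Fin.tail t))
    {w : ℂ} (hw : ‖w‖ < t 0) : (Fin.cons w z' : Fin (n+1) → ℂ) ∈ PD t := by
  intro j
  refine Fin.cases ?_ (fun i => ?_) j
  · simpa using hw
  · simpa [Fin.tail] using hz i

lemma slice_diff {n : ℕ} {t : Fin (n+1) → ℝ} {g : (Fin (n+1) → ℂ) → ℂ}
    (hg : DifferentiableOn ℂ g (PD t)) {z' : Fin n → ℂ} (hz : z' ∈ PD (Fin.tail t)) :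
    DifferentiableOn ℂ (fun w : ℂ => g (Fin.cons w z')) (Metric.ball 0 (t 0)) := by
  refine hg.comp (differentiable_cons_left z').differentiableOn ?_
  intro w hw
  exact cons_mem_PD hz (by simpa using hw)

lemma ac_bound {n : ℕ} {t : Fin (n+1) → ℝ} (ht : ∀ j, 0 < t j) {g : (Fin (n+1) → ℂ) → ℂ} {B : ℝ}
    (hg : DifferentiableOn ℂ g (PD t)) (hB : ∀ z ∈ PD t, ‖g z‖ ≤ B) (m : ℕ)
    {z' : Fin n → ℂ} (hz : z' ∈ PD (Fin.tail t)) : ‖ac m g z'‖ ≤ B / t 0 ^ m := by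
  rw [le_div_iff₀ (pow_pos (ht 0) m)]
  have key : ∀ r, 0 < r → r < t 0 → ‖ac m g z'‖ * r ^ m ≤ B := by
    intro r hr hrt
    have h1 : DifferentiableOn ℂ (fun w : ℂ => g (Fin.cons w z')) (Metric.closedBall 0 r) :=
      (slice_diff hg hz).mono (Metric.closedBall_subset_ball hrt)
    have h2 := Complex.norm_iteratedDeriv_le_of_forall_mem_sphere_norm_le (C := B) m hr
      (h1.mono Metric.closure_ball_subset_closedBall).diffContOnCl (by
        intro w hw
        have : ‖w‖ = r := by simpa using hw
        exact hB _ (cons_mem_PD hz (by rw [this]; exact hrt)))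
    rw [ac, norm_mul, norm_inv, Complex.norm_natCast]
    have hf : (0:ℝ) < m.factorial := by exact_mod_cast m.factorial_pos
    rw [le_div_iff₀ (pow_pos hr m)] at h2
    rw [mul_assoc, inv_mul_le_iff₀ hf]
    exact h2
  have hlim : Filter.Tendsto (fun r : ℝ => ‖ac m g z'‖ * r ^ m) (nhdsWithin (t 0) (Iio (t 0)))
      (nhds (‖ac m g z'‖ * t 0 ^ m)) := by
    have : Continuous (fun r : ℝ => ‖ac m g z'‖ * r ^ m) := by fun_prop
    exact (this.tendsto (t 0)).mono_left nhdsWithin_le_nhds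
  refine le_of_tendsto hlim ?_
  filter_upwards [Ioo_mem_nhdsLT (ht 0)] with r hr
  exact key r hr.1 hr.2

lemma PD_ball {n : ℕ} {t : Fin n → ℝ} {z y : Fin n → ℂ} {ε : ℝ}
    (hz : ∀ j, ‖z j‖ + ε ≤ t j) (hy : y ∈ Metric.ball z ε) : y ∈ PD t := by
  intro j
  have h1 : ‖y j - z j‖ < ε := by
    have := norm_le_pi_norm (y - z) j
    rw [mem_ball_iff_norm] at hy
    exact lt_of_le_of_lt (by simpa using this) hy
  have h2 := norm_add_le (z j) (y j - z j)
  have h3 : z j + (y j - z j) = y j := by ring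
  rw [h3] at h2
  linarith [hz j]

lemma fderiv_bound {n : ℕ} {t : Fin n → ℝ} {g : (Fin n → ℂ) → ℂ} {B : ℝ}
    (hg : DifferentiableOn ℂ g (PD t)) (hB : ∀ z ∈ PD t, ‖g z‖ ≤ B) {z : Fin n → ℂ} {ε : ℝ}
    (hε : 0 < ε) (hz : ∀ j, ‖z j‖ + ε ≤ t j) : ‖fderiv ℂ g z‖ ≤ 2 * B / ε := by
  apply Complex.norm_fderiv_le_div_of_mapsTo_ball _ _ hε
  · exact hg.mono fun y hy => PD_ball hz hy
  · intro y hy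
    have h1 := hB y (PD_ball hz hy)
    have h2 := hB z (PD_ball hz (Metric.mem_ball_self hε))
    rw [mem_closedBall_iff_norm]
    linarith [norm_sub_le (g y) (g z)]

lemma ac_diff {n : ℕ} {t : Fin (n+1) → ℝ} (ht : ∀ j, 0 < t j) {g : (Fin (n+1) → ℂ) → ℂ} {B : ℝ}
    (hg : DifferentiableOn ℂ g (PD t)) (hB : ∀ z ∈ PD t, ‖g z‖ ≤ B) (m : ℕ) :
    DifferentiableOn ℂ (ac m g) (PD (Fin.tail t)) := by
  intro z0 hz0
  apply DifferentiableAt.differentiableWithinAt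
  have ht0 := ht 0
  obtain ⟨ε, hε, hε1, hε2⟩ : ∃ ε : ℝ, 0 < ε ∧ t 0 / 2 + ε ≤ t 0 ∧
      ∀ j, ‖z0 j‖ + 2 * ε ≤ t j.succ := by
    have h1 : ∀ᶠ ε in nhdsWithin (0:ℝ) (Ioi 0), ∀ j : Fin n, ‖z0 j‖ + 2 * ε ≤ t j.succ := by
      rw [Filter.eventually_all]
      intro j
      have h2 : Filter.Tendsto (fun ε : ℝ => ‖z0 j‖ + 2 * ε) (nhds 0) (nhds (‖z0 j‖ + 2 * 0)) :=
        Continuous.tendsto (by fun_prop) 0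
      have h3 : ‖z0 j‖ + 2 * 0 < t j.succ := by simpa [Fin.tail] using hz0 j
      exact ((h2.mono_left nhdsWithin_le_nhds).eventually (gt_mem_nhds h3)).mono fun _ h => h.le
    have h4 : ∀ᶠ ε in nhdsWithin (0:ℝ) (Ioi 0), ε ∈ Ioo 0 (t 0 / 2) :=
      Ioo_mem_nhdsGT (by linarith)
    obtain ⟨ε, h5, h6⟩ := (h1.and h4).exists
    exact ⟨ε, h6.1, by linarith [h6.2], h5⟩
  set r := t 0 / 2 with hr
  have hr0 : 0 < r := by positivity
  have hpt : ∀ w : ℂ, ‖w‖ = r → ∀ y ∈ Metric.ball z0 ε, ∀ j,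
      ‖(Fin.cons w y : Fin (n+1) → ℂ) j‖ + ε ≤ t j := by
    intro w hw y hy j
    refine Fin.cases ?_ (fun i => ?_) j
    · simp only [Fin.cons_zero]; rw [hw]; exact hε1
    · simp only [Fin.cons_succ]
      have := PD_ball (t := fun j => ‖z0 j‖ + ε) (fun j => le_rfl) hy i
      simp only at this
      linarith [hε2 i]
  have hmemPD : ∀ w : ℂ, ‖w‖ = r → ∀ y ∈ Metric.ball z0 ε,
      (Fin.cons w y : Fin (n+1) → ℂ) ∈ PD t := fun w hw y hy =>
    PD_ball (hpt w hw y hy) (Metric.mem_ball_self hε)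
  set cm : ℝ → ℂ := circleMap 0 r with hcm
  have hcmn : ∀ θ, ‖cm θ‖ = r := by intro θ; simp [hcm, abs_of_pos hr0]
  have hcmc : Continuous cm := continuous_circleMap 0 r
  set cc : ℝ → ℂ := fun θ => deriv (circleMap 0 r) θ * (1 / (cm θ - 0) ^ (m+1)) with hcc
  have hccc : Continuous cc := by
    have h1 : Continuous (fun θ => deriv (circleMap 0 r) θ) := by
      simp only [deriv_circleMap]; fun_prop
    refine h1.mul (continuous_const.div (by fun_prop) ?_)
    intro θ h
    have h2 := hcmn θ
    have : cm θ = 0 := by simpa using h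
    rw [this] at h2; simp at h2; linarith
  have hrep : ∀ y ∈ PD (Fin.tail t), ac m g y = (2 * Real.pi * Complex.I)⁻¹ *
      ∫ θ in (0:ℝ)..(2 * Real.pi), cc θ * g (Fin.cons (cm θ) y) := by
    intro y hy
    have h1 : DifferentiableOn ℂ (fun w : ℂ => g (Fin.cons w y)) (Metric.closedBall 0 r) :=
      (slice_diff hg hy).mono (Metric.closedBall_subset_ball (by linarith))
    have h2 := h1.circleIntegral_one_div_sub_center_pow_smul hr0 m
    have h3 : (∮ z in C(0, r), (1 / (z - 0) ^ (m + 1)) • g (Fin.cons z y)) =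
        ∫ θ in (0:ℝ)..(2 * Real.pi), cc θ * g (Fin.cons (cm θ) y) := by
      rw [circleIntegral]
      congr 1
      ext θ
      simp only [smul_eq_mul, hcc, hcm]; ring
    rw [← h3, h2, ac, smul_eq_mul]
    have : (Real.pi : ℂ) ≠ 0 := by exact_mod_cast Real.pi_ne_zero
    have hf : (m.factorial : ℂ) ≠ 0 := by exact_mod_cast m.factorial_ne_zero
    field_simp
  set LL : (Fin n → ℂ) →L[ℂ] (Fin (n+1) → ℂ) := ContinuousLinearMap.pi
    (Fin.cons (0 : (Fin n → ℂ) →L[ℂ] ℂ) fun i => ContinuousLinearMap.proj i) with hLL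
  have hcons : ∀ y : Fin n → ℂ, Continuous (fun θ => (Fin.cons (cm θ) y : Fin (n+1) → ℂ)) :=
    fun y => (differentiable_cons_left y).continuous.comp hcmc
  have hFc : ∀ y ∈ Metric.ball z0 ε, Continuous (fun θ => cc θ * g (Fin.cons (cm θ) y)) := by
    intro y hy
    refine hccc.mul ?_
    exact hg.continuousOn.comp_continuous (hcons y) (fun θ => hmemPD _ (hcmn θ) y hy)
  have : FiniteDimensional ℂ ((Fin n → ℂ) →L[ℂ] ℂ) := inferInstance
  have : ProperSpace ((Fin n → ℂ) →L[ℂ] ℂ) := FiniteDimensional.proper ℂ _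
  have : SecondCountableTopology ((Fin n → ℂ) →L[ℂ] ℂ) := secondCountable_of_proper
  have : ProperSpace ((Fin (n+1) → ℂ) →L[ℂ] ℂ) := FiniteDimensional.proper ℂ _
  have : SecondCountableTopology ((Fin (n+1) → ℂ) →L[ℂ] ℂ) := secondCountable_of_proper
  have hmain := intervalIntegral.hasFDerivAt_integral_of_dominated_of_fderiv_le
    (𝕜 := ℂ) (μ := MeasureTheory.volume) (a := 0) (b := 2 * Real.pi)
    (F := fun (y : Fin n → ℂ) (θ : ℝ) => cc θ * g (Fin.cons (cm θ) y))
    (F' := fun (y : Fin n → ℂ) (θ : ℝ) => cc θ • (fderiv ℂ g (Fin.cons (cm θ) y)).comp LL)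
    (x₀ := z0) (s := Metric.ball z0 ε) (bound := fun θ => ‖cc θ‖ * (2 * B / ε * ‖LL‖))
    (Metric.ball_mem_nhds z0 hε)
    (by
      filter_upwards [Metric.ball_mem_nhds z0 hε] with y hy
      exact (hFc y hy).aestronglyMeasurable)
    ((hFc z0 (Metric.mem_ball_self hε)).intervalIntegrable _ _)
    (by
      refine MeasureTheory.AEStronglyMeasurable.smul (f := cc)
        (g := fun θ => (fderiv ℂ g (Fin.cons (cm θ) z0)).comp LL) ?_ ?_
      · exact hccc.aestronglyMeasurable
      · have h1 : Measurable (fun θ => fderiv ℂ g (Fin.cons (cm θ) z0)) :=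
          (measurable_fderiv ℂ g).comp (hcons z0).measurable
        have h2 : Continuous (fun T : (Fin (n+1) → ℂ) →L[ℂ] ℂ => T.comp LL) := by fun_prop
        exact h2.comp_aestronglyMeasurable h1.aestronglyMeasurable)
    (by
      filter_upwards with θ _ y hy
      rw [norm_smul]
      refine mul_le_mul_of_nonneg_left ?_ (norm_nonneg _)
      refine (ContinuousLinearMap.opNorm_comp_le _ _).trans ?_
      exact mul_le_mul_of_nonneg_right (fderiv_bound hg hB hε (hpt _ (hcmn θ) y hy))
        (norm_nonneg _))
    (by
      apply Continuous.intervalIntegrable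
      fun_prop)
    (by
      filter_upwards with θ _ y hy
      have h1 : DifferentiableAt ℂ g (Fin.cons (cm θ) y) :=
        (hg _ (hmemPD _ (hcmn θ) y hy)).differentiableAt
          ((isOpen_PD t).mem_nhds (hmemPD _ (hcmn θ) y hy))
      have h2 := h1.hasFDerivAt.comp y (hasFDerivAt_cons_right (cm θ) y)
      exact h2.const_mul (cc θ))
  have h5 := (hmain.const_mul ((2 * Real.pi * Complex.I)⁻¹)).differentiableAt
  refine h5.congr_of_eventuallyEq ?_
  filter_upwards [(isOpen_PD _).mem_nhds hz0] with y hy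
  exact hrep y hy

end partD


section partD2

/-- Taylor coefficients -/
def coef : (n : ℕ) → ((Fin n → ℂ) → ℂ) → (Fin n → ℕ) → ℂ
  | 0, g, _ => g default
  | (n+1), g, k => coef n (ac (k 0) g) (Fin.tail k)

lemma PD_tail_pos {n : ℕ} {t : Fin (n+1) → ℝ} (ht : ∀ j, 0 < t j) : ∀ j, 0 < Fin.tail t j :=
  fun j => ht j.succ

lemma coef_bound {n : ℕ} : ∀ {t : Fin n → ℝ}, (∀ j, 0 < t j) → ∀ {g : (Fin n → ℂ) → ℂ} {B : ℝ},
    DifferentiableOn ℂ g (PD t) → (∀ z ∈ PD t, ‖g z‖ ≤ B) → ∀ k : Fin n → ℕ,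
    ‖coef n g k‖ * ∏ j, t j ^ k j ≤ B := by
  induction n with
  | zero =>
    intro t ht g B hg hB k
    simpa [coef] using hB default (fun j => j.elim0)
  | succ n ih =>
    intro t ht g B hg hB k
    have h1 := ih (PD_tail_pos ht) (ac_diff ht hg hB (k 0))
      (fun z hz => ac_bound ht hg hB (k 0) hz) (Fin.tail k)
    rw [le_div_iff₀ (pow_pos (ht 0) _)] at h1
    rw [Fin.prod_univ_succ, coef]
    refine le_trans (le_of_eq ?_) h1
    simp only [Fin.tail]
    ring

lemma coef_sub {n : ℕ} : ∀ {t : Fin n → ℝ}, (∀ j, 0 < t j) →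
    ∀ {g1 g2 g3 : (Fin n → ℂ) → ℂ} {B1 B2 : ℝ},
    DifferentiableOn ℂ g1 (PD t) → (∀ z ∈ PD t, ‖g1 z‖ ≤ B1) →
    DifferentiableOn ℂ g2 (PD t) → (∀ z ∈ PD t, ‖g2 z‖ ≤ B2) →
    (∀ z ∈ PD t, g3 z = g1 z - g2 z) → ∀ k : Fin n → ℕ,
    coef n g3 k = coef n g1 k - coef n g2 k := by
  induction n with
  | zero =>
    intro t ht g1 g2 g3 B1 B2 _ _ _ _ h k
    simpa [coef] using h default (fun j => j.elim0)
  | succ n ih =>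
    intro t ht g1 g2 g3 B1 B2 h1 hB1 h2 hB2 h k
    refine ih (PD_tail_pos ht) (ac_diff ht h1 hB1 (k 0)) (fun z hz => ac_bound ht h1 hB1 (k 0) hz)
      (ac_diff ht h2 hB2 (k 0)) (fun z hz => ac_bound ht h2 hB2 (k 0) hz) ?_ (Fin.tail k)
    intro z hz
    have hb : Metric.ball (0:ℂ) (t 0) ∈ nhds (0:ℂ) := Metric.ball_mem_nhds 0 (ht 0)
    have e : (fun w : ℂ => g3 (Fin.cons w z)) =ᶠ[nhds 0]
        fun w => g1 (Fin.cons w z) - g2 (Fin.cons w z) := by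
      filter_upwards [hb] with w hw
      exact h _ (cons_mem_PD hz (by simpa using hw))
    rw [ac, ac, ac, e.iteratedDeriv_eq]
    have a1 := ((slice_diff h1 hz).analyticAt hb).contDiffAt (n := (k 0 : ℕ))
    have a2 := ((slice_diff h2 hz).analyticAt hb).contDiffAt (n := (k 0 : ℕ))
    rw [iteratedDeriv_fun_sub a1 a2]
    ring

/-- geometric series in several variables -/
lemma hasSum_geom {n : ℕ} : ∀ {x : Fin n → ℝ}, (∀ j, 0 ≤ x j) → (∀ j, x j < 1) →
    HasSum (fun k : Fin n → ℕ => ∏ j, x j ^ k j) (∏ j, (1 - x j)⁻¹) := by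
  induction n with
  | zero =>
    intro x _ _
    simpa using hasSum_unique (fun k : Fin 0 → ℕ => ∏ j, x j ^ k j)
  | succ n ih =>
    intro x h0 h1
    have hA := hasSum_geometric_of_lt_one (h0 0) (h1 0)
    have hB := ih (x := Fin.tail x) (fun j => h0 _) (fun j => h1 _)
    have hS : Summable (fun p : ℕ × (Fin n → ℕ) => x 0 ^ p.1 * ∏ j, Fin.tail x j ^ p.2 j) :=
      Summable.mul_of_nonneg (f := fun m : ℕ => x 0 ^ m)
        (g := fun k : Fin n → ℕ => ∏ j, Fin.tail x j ^ k j) hA.summable hB.summable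
        (fun m => pow_nonneg (h0 0) m)
        (fun k => Finset.prod_nonneg fun j _ => pow_nonneg (h0 _) _)
    have hC := HasSum.mul hA hB hS
    rw [Fin.prod_univ_succ]
    rw [← (Fin.consEquiv (fun _ : Fin (n+1) => ℕ)).hasSum_iff]
    have e : ((fun k : Fin (n+1) → ℕ => ∏ j, x j ^ k j) ∘ (Fin.consEquiv (fun _ : Fin (n+1) => ℕ)))
        = fun p : ℕ × (Fin n → ℕ) => x 0 ^ p.1 * ∏ j, Fin.tail x j ^ p.2 j := by
      funext p
      simp [Fin.consEquiv, Fin.prod_univ_succ, Fin.tail]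
    rw [e]
    exact hC

lemma coef_summable {n : ℕ} {t : Fin n → ℝ} (ht : ∀ j, 0 < t j) {g : (Fin n → ℂ) → ℂ} {B : ℝ}
    (hg : DifferentiableOn ℂ g (PD t)) (hB : ∀ z ∈ PD t, ‖g z‖ ≤ B) {z : Fin n → ℂ}
    (hz : z ∈ PD t) : Summable (fun k : Fin n → ℕ => coef n g k * ∏ j, z j ^ k j) := by
  have h1 := (hasSum_geom (x := fun j => ‖z j‖ / t j) (fun j => div_nonneg (norm_nonneg _) (ht j).le)
    (fun j => (div_lt_one (ht j)).2 (hz j))).summable.mul_left B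
  refine Summable.of_norm_bounded h1 ?_
  intro k
  have h2 := coef_bound ht hg hB k
  have hp : 0 < ∏ j, t j ^ k j := Finset.prod_pos fun j _ => pow_pos (ht j) _
  rw [norm_mul, norm_prod]
  simp only [div_pow, norm_pow, Finset.prod_div_distrib]
  rw [← le_div_iff₀ hp] at h2
  calc _ ≤ B / (∏ j, t j ^ k j) * ∏ j, ‖z j‖ ^ k j :=
        mul_le_mul_of_nonneg_right h2 (by positivity)
    _ = _ := by ring

lemma coef_hasSum {n : ℕ} : ∀ {t : Fin n → ℝ}, (∀ j, 0 < t j) → ∀ {g : (Fin n → ℂ) → ℂ} {B : ℝ},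
    DifferentiableOn ℂ g (PD t) → (∀ z ∈ PD t, ‖g z‖ ≤ B) → ∀ z ∈ PD t,
    HasSum (fun k : Fin n → ℕ => coef n g k * ∏ j, z j ^ k j) (g z) := by
  induction n with
  | zero =>
    intro t _ g B _ _ z _
    have : z = default := Subsingleton.elim _ _
    rw [this]
    simpa [coef] using hasSum_unique (fun k : Fin 0 → ℕ => coef 0 g k)
  | succ n ih =>
    intro t ht g B hg hB z hz
    have hs := coef_summable ht hg hB hz
    have hz' : Fin.tail z ∈ PD (Fin.tail t) := fun j => hz j.succ
    have h1 := (Fin.consEquiv (fun _ : Fin (n+1) => ℕ)).hasSum_iff.2 hs.hasSum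
    have h2 := h1.prod_fiberwise (g := fun m => ac m g (Fin.tail z) * z 0 ^ m) (by
      intro m
      have := (ih (PD_tail_pos ht) (ac_diff ht hg hB m) (fun y hy => ac_bound ht hg hB m hy)
        (Fin.tail z) hz').mul_right (z 0 ^ m)
      have e : ∀ c, ((fun k => coef (n + 1) g k * ∏ x, z x ^ k x) ∘
          (Fin.consEquiv fun _ : Fin (n+1) => ℕ)) (m, c) =
          (coef n (ac m g) c * ∏ x, Fin.tail z x ^ c x) * z 0 ^ m := by
        intro c
        simp only [Function.comp, Fin.consEquiv, Equiv.coe_fn_mk, Fin.prod_univ_succ, coef,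
          Fin.cons_zero, Fin.cons_succ, Fin.tail_cons, Fin.tail]
        ring
      simp only [e]
      exact this)
    have h3 := Complex.hasSum_taylorSeries_on_ball (slice_diff hg hz') (z := z 0)
      (by simpa using hz 0)
    have h4 : HasSum (fun m => ac m g (Fin.tail z) * z 0 ^ m) (g z) := by
      have e : ∀ m, (m.factorial : ℂ)⁻¹ • (z 0 - 0) ^ m •
          iteratedDeriv m (fun w : ℂ => g (Fin.cons w (Fin.tail z))) 0 =
          ac m g (Fin.tail z) * z 0 ^ m := by
        intro m
        simp only [ac, smul_eq_mul, sub_zero]; ring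
      simp only [e] at h3
      rwa [Fin.cons_self_tail] at h3
    rw [h4.unique h2]
    exact hs.hasSum

end partD2


lemma holo_tsum {n : ℕ} {κ : Type} {U : Set (Fin n → ℂ)} (hU : IsOpen U)
    (f : κ → (Fin n → ℂ) → ℂ) (b : κ → ℝ) (hb : Summable b) (hf : ∀ k, ContDiff ℂ 1 (f k))
    (hfb : ∀ k, ∀ z ∈ U, ‖f k z‖ ≤ b k) :
    ContDiffOn ℂ 1 (fun z => ∑' k, f k z) U := by
  intro z0 hz0
  apply ContDiffAt.contDiffWithinAt
  obtain ⟨ε', hε', hsub'⟩ := Metric.isOpen_iff.1 hU z0 hz0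
  obtain ⟨ε, rfl⟩ : ∃ ε, ε' = ε + ε := ⟨ε' / 2, by ring⟩
  have hε : 0 < ε := by linarith
  have hfd : ∀ k, ∀ y ∈ Metric.ball z0 ε, ‖fderiv ℂ (f k) y‖ ≤ 2 * b k / ε := by
    intro k y hy
    have hsub : Metric.ball y ε ⊆ U := by
      refine subset_trans (Metric.ball_subset_ball' ?_) hsub'
      rw [Metric.mem_ball] at hy; linarith
    apply Complex.norm_fderiv_le_div_of_mapsTo_ball _ _ hε
    · exact ((hf k).differentiable (by norm_num)).differentiableOn
    · intro x hx
      have h1 := hfb k x (hsub hx)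
      have h2 := hfb k y (hsub (Metric.mem_ball_self hε))
      rw [mem_closedBall_iff_norm]
      linarith [norm_sub_le (f k x) (f k y)]
  have hs2 : Summable (fun k => 2 * b k / ε) := (hb.mul_left 2).div_const ε
  have hsum0 : Summable (fun k => f k z0) := Summable.of_norm_bounded hb (fun k => hfb k z0 hz0)
  have hD : ∀ y ∈ Metric.ball z0 ε, HasFDerivAt (fun z => ∑' k, f k z)
      (∑' k, fderiv ℂ (f k) y) y := by
    intro y hy
    exact hasFDerivAt_tsum_of_isPreconnected hs2 Metric.isOpen_ball
      (convex_ball z0 ε).isPreconnected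
      (fun k x _ => ((hf k).differentiable (by norm_num) x).hasFDerivAt) hfd
      (Metric.mem_ball_self hε) hsum0 hy
  have hC : ContinuousOn (fun y => ∑' k, fderiv ℂ (f k) y) (Metric.ball z0 ε) :=
    continuousOn_tsum (fun k => ((hf k).continuous_fderiv (by norm_num)).continuousOn) hs2
      (fun k x hx => hfd k x hx)
  have : ContDiffOn ℂ 1 (fun z => ∑' k, f k z) (Metric.ball z0 ε) := by
    rw [show (1 : WithTop ℕ∞) = 0 + 1 by norm_num, contDiffOn_succ_iff_fderiv_of_isOpen Metric.isOpen_ball]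
    refine ⟨fun y hy => (hD y hy).differentiableAt.differentiableWithinAt, by simp, ?_⟩
    rw [contDiffOn_zero]
    exact hC.congr fun y hy => (hD y hy).fderiv
  exact this.contDiffAt (Metric.ball_mem_nhds z0 hε)


lemma key_one {x y s : ℝ} (hx : 0 ≤ x) (hy : 0 < y) (hs0 : 0 ≤ s) (hs1 : s ≤ 1) :
    x ≤ ((1 - s) * x + s * y) * Real.exp (s * (x / y - 1)) := by
  have hq : 0 ≤ (1 - s) * x + s * y := by
    have := sub_nonneg.2 hs1
    positivity
  have h1 : s * (x / y - 1) + 1 ≤ Real.exp (s * (x / y - 1)) := Real.add_one_le_exp _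
  refine le_trans ?_ (mul_le_mul_of_nonneg_left h1 hq)
  set v := x / y with hv
  have hxv : x = v * y := by rw [hv]; field_simp
  rw [hxv]
  have h2 : 0 ≤ (1 - s) * s * (v - 1) ^ 2 * y := by
    have := sub_nonneg.2 hs1
    positivity
  nlinarith

lemma key_ineq {n : ℕ} {x q r p : Fin n → ℝ} {k : Fin n → ℕ} {a τ s : ℝ} (ha : 0 < a) (hτ : 0 ≤ τ)
    (hs0 : 0 ≤ s) (hs1 : s ≤ 1)
    (hx0 : ∀ j, 0 ≤ x j) (hxa : ∑ j, x j ≤ a) (hxr : ∀ j, x j ≤ r j)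
    (hp : ∀ j, p j = a * k j / (∑ i, k i : ℕ) + τ)
    (hq : ∀ j, q j = r j + s * (p j - r j)) :
    ∏ j, x j ^ k j ≤ ∏ j, q j ^ k j := by
  set K : ℝ := ((∑ i, k i : ℕ) : ℝ) with hK
  have hK0 : 0 ≤ K := Nat.cast_nonneg _
  have hs1' := sub_nonneg.2 hs1
  have hqge : ∀ j, (1 - s) * x j + s * (a * k j / K) ≤ q j := by
    intro j
    rw [hq, hp]
    have := mul_le_mul_of_nonneg_left (hxr j) hs1'
    have := mul_nonneg hs0 hτ
    nlinarith
  have hq0 : ∀ j, 0 ≤ q j := by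
    intro j
    refine le_trans ?_ (hqge j)
    have := hx0 j
    positivity
  have h1 : ∀ j, x j ^ k j ≤ q j ^ k j * Real.exp (s * (x j * K / a - k j)) := by
    intro j
    rcases Nat.eq_zero_or_pos (k j) with h | h
    · rw [h]
      simp only [pow_zero, one_mul, Nat.cast_zero, sub_zero]
      apply Real.one_le_exp
      have := hx0 j
      positivity
    · have hkj : (0:ℝ) < k j := by exact_mod_cast h
      have hKpos : 0 < K := by
        refine lt_of_lt_of_le hkj ?_
        rw [hK]
        exact_mod_cast Finset.single_le_sum (f := k) (fun i _ => Nat.zero_le _) (Finset.mem_univ j)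
      have hy : 0 < a * k j / K := by positivity
      have h2 := key_one (hx0 j) hy hs0 hs1
      have h3 : x j ≤ q j * Real.exp (s * (x j / (a * k j / K) - 1)) :=
        h2.trans (mul_le_mul_of_nonneg_right (hqge j) (Real.exp_nonneg _))
      have h4 := pow_le_pow_left₀ (hx0 j) h3 (k j)
      rw [mul_pow, ← Real.exp_nat_mul] at h4
      refine h4.trans (le_of_eq ?_)
      congr 2
      field_simp
  have h2 : ∏ j, x j ^ k j ≤ ∏ j, (q j ^ k j * Real.exp (s * (x j * K / a - k j))) :=
    Finset.prod_le_prod (fun j _ => pow_nonneg (hx0 j) _) (fun j _ => h1 j)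
  rw [Finset.prod_mul_distrib, ← Real.exp_sum] at h2
  refine h2.trans ?_
  have hnn : 0 ≤ ∏ j, q j ^ k j := Finset.prod_nonneg fun j _ => pow_nonneg (hq0 j) _
  have h3 : ∑ j, s * (x j * K / a - k j) ≤ 0 := by
    rw [← Finset.mul_sum, Finset.sum_sub_distrib, ← Finset.sum_div, ← Finset.sum_mul]
    have h4 : (∑ j, (k j : ℝ)) = K := by rw [hK]; push_cast; rfl
    rw [h4]
    have h5 : (∑ j, x j) * K / a ≤ K := by
      rw [div_le_iff₀ ha]; nlinarith
    nlinarith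
  calc _ ≤ (∏ j, q j ^ k j) * 1 :=
        mul_le_mul_of_nonneg_left (Real.exp_le_one_iff.2 h3) hnn
    _ = _ := mul_one _

/-- the open unit ball for the l1 norm -/
def BL (n : ℕ) (ρ : ℝ) : Set (Fin n → ℂ) := {z | ∑ j, ‖z j‖ < ρ}

lemma isOpen_BL (n : ℕ) (ρ : ℝ) : IsOpen (BL n ρ) :=
  isOpen_lt (by fun_prop) continuous_const

/-- diagonal map -/
def diagL {n : ℕ} (r : Fin n → ℝ) : (Fin n → ℂ) →L[ℂ] (Fin n → ℂ) :=
  ContinuousLinearMap.pi fun j => (r j : ℂ) • ContinuousLinearMap.proj j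

lemma diagL_apply {n : ℕ} (r : Fin n → ℝ) (z : Fin n → ℂ) (j : Fin n) :
    diagL r z j = r j * z j := by simp [diagL]

lemma diagL_single {n : ℕ} (r : Fin n → ℝ) (j : Fin n) :
    diagL r (Pi.single j 1) = (r j : ℂ) • (Pi.single j (1:ℂ) : Fin n → ℂ) := by
  ext i
  rw [diagL_apply]
  by_cases h : i = j
  · subst h; simp
  · simp [h]

lemma db_diag {n : ℕ} (r : Fin n → ℝ) (u : (Fin n → ℂ) → ℂ) (z : Fin n → ℂ) (j : Fin n)
    (hu : DifferentiableAt ℝ u (diagL r z)) :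
    db j (fun w => u (diagL r w)) z = r j * db j u (diagL r z) := by
  rw [db, dbar_comp (diagL r) u z _ hu, diagL_single, dbar_dir_smul, db]
  simp

lemma poly_solve_r (δ : ℝ) (hδ : 0 < δ) : ∃ A : ℝ, 1 ≤ A ∧ ∀ (n : ℕ)
    (F : Fin n → (Fin n → ℂ) → ℂ) (M : ℝ), 0 ≤ M →
      (∀ j, ContDiffOn ℝ 1 (F j) (BL n 1)) →
      (∀ i j, ∀ z ∈ BL n 1, db i (F j) z = db j (F i) z) →
      (∀ j, ∀ z ∈ BL n 1, ‖F j z‖ ≤ M) →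
      ∀ r : Fin n → ℝ, (∀ j, 0 < r j) → (1 + δ) * ∑ j, r j < 1 →
      ∃ u : (Fin n → ℂ) → ℂ, ContDiffOn ℝ 1 u (PD r) ∧
        (∀ j, ∀ z ∈ PD r, db j u z = F j z) ∧
        (∀ z ∈ PD r, ‖u z‖ ≤ A ^ n * M) := by
  obtain ⟨A, hA1, hA⟩ := poly_solve δ hδ
  refine ⟨A, hA1, ?_⟩
  intro n F M hM hF hcl hb r hr hrs
  have hmap : ∀ z ∈ PD (fun _ : Fin n => 1 + δ), diagL r z ∈ BL n 1 := by
    intro z hz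
    refine lt_of_le_of_lt ?_ hrs
    rw [Finset.mul_sum]
    refine Finset.sum_le_sum fun j _ => ?_
    rw [diagL_apply, norm_mul, Complex.norm_real, Real.norm_of_nonneg (hr j).le, mul_comm]
    exact mul_le_mul_of_nonneg_right (hz j).le (hr j).le
  have hr1 : ∀ j, r j ≤ 1 := by
    intro j
    have h1 : r j ≤ ∑ i, r i := Finset.single_le_sum (fun i _ => (hr i).le) (Finset.mem_univ j)
    have h2 : 0 ≤ δ * ∑ i, r i := mul_nonneg hδ.le (Finset.sum_nonneg fun i _ => (hr i).le)
    linarith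
  have hdF : ∀ j, ∀ z ∈ PD (fun _ : Fin n => 1 + δ), DifferentiableAt ℝ (F j) (diagL r z) :=
    fun j z hz => ((hF j).contDiffAt ((isOpen_BL n 1).mem_nhds (hmap z hz))).differentiableAt
      (by norm_num)
  have hdC : ∀ r : Fin n → ℝ, ContDiff ℝ 1 (fun z => diagL r z) := fun r =>
    ((diagL r).restrictScalars ℝ).contDiff
  have hdG : ∀ j, ∀ z ∈ PD (fun _ : Fin n => 1 + δ),
      DifferentiableAt ℝ (fun z => F j (diagL r z)) z := fun j z hz =>
    DifferentiableAt.comp z (hdF j z hz) ((hdC r).differentiable (by norm_num) z)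
  obtain ⟨v, hv1, hv2, hv3⟩ := hA n (fun j z => (r j : ℂ) * F j (diagL r z)) M hM
    (fun j => contDiffOn_const.mul ((hF j).comp (hdC r).contDiffOn hmap))
    (by
      intro i j z hz
      have h1 : ∀ i j, db i (fun z => (r j : ℂ) * F j (diagL r z)) z =
          r j * (r i * db i (F j) (diagL r z)) := by
        intro i j
        rw [← db_diag r (F j) z i (hdF j z hz), db, dbar_const_mul _ _ _ _ (hdG j z hz), db]
      rw [h1, h1, hcl i j _ (hmap z hz)]
      ring)
    (by
      intro j z hz
      rw [norm_mul, Complex.norm_real, Real.norm_of_nonneg (hr j).le]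
      calc r j * ‖F j (diagL r z)‖ ≤ 1 * M :=
            mul_le_mul (hr1 j) (hb j _ (hmap z hz)) (norm_nonneg _) zero_le_one
        _ = M := one_mul M)
  have hinv : ∀ z ∈ PD r, diagL (fun j => (r j)⁻¹) z ∈ PD (fun _ : Fin n => (1:ℝ)) := by
    intro z hz j
    rw [diagL_apply, norm_mul, Complex.norm_real, Real.norm_of_nonneg (inv_nonneg.2 (hr j).le),
      inv_mul_lt_iff₀ (hr j), mul_one]
    exact hz j
  have hid : ∀ z, diagL r (diagL (fun j => (r j)⁻¹) z) = z := by
    intro z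
    ext j
    rw [diagL_apply, diagL_apply]
    have : (r j : ℂ) ≠ 0 := by exact_mod_cast (hr j).ne'
    push_cast
    field_simp
  refine ⟨fun z => v (diagL (fun j => (r j)⁻¹) z), hv1.comp (hdC _).contDiffOn hinv, ?_,
    fun z hz => hv3 _ (hinv z hz)⟩
  intro j z hz
  rw [db_diag, hv2 j _ (hinv z hz), hid]
  · have : (r j : ℂ) ≠ 0 := by exact_mod_cast (hr j).ne'
    push_cast
    field_simp
  · exact (hv1.contDiffAt ((isOpen_PD _).mem_nhds (hinv z hz))).differentiableAt (by norm_num)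


/-- admissible radii -/
def Adm {n : ℕ} (τ σ : ℝ) (r : Fin n → ℝ) : Prop := (∀ j, τ ≤ r j) ∧ ∑ j, r j ≤ σ

/-- special radii -/
def pk {n : ℕ} (a τ : ℝ) (k : Fin n → ℕ) : Fin n → ℝ :=
  fun j => a * k j / (∑ i, k i : ℕ) + τ

lemma adm_pk {n : ℕ} {a τ σ : ℝ} (ha : 0 < a) (hs : a + n * τ ≤ σ) (k : Fin n → ℕ) :
    Adm τ σ (pk a τ k) := by
  refine ⟨fun j => ?_, ?_⟩
  · have : 0 ≤ a * k j / (∑ i, k i : ℕ) := by positivity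
    simp only [pk]; linarith
  · refine le_trans ?_ hs
    simp only [pk, Finset.sum_add_distrib, ← Finset.sum_div, ← Finset.mul_sum]
    simp only [Finset.sum_const, Finset.card_univ, Fintype.card_fin, nsmul_eq_mul]
    have : a * (∑ i, (k i : ℝ)) / ((∑ i, k i : ℕ) : ℝ) ≤ a := by
      push_cast
      have h0 : 0 ≤ ∑ i, (k i : ℝ) := Finset.sum_nonneg fun i _ => Nat.cast_nonneg _
      exact div_le_of_le_mul₀ h0 ha.le le_rfl
    linarith

lemma Adm.seg {n : ℕ} {τ σ s : ℝ} {r p q : Fin n → ℝ} (hr : Adm τ σ r) (hp : Adm τ σ p)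
    (hs0 : 0 ≤ s) (hs1 : s ≤ 1) (hq : ∀ j, q j = r j + s * (p j - r j)) : Adm τ σ q := by
  refine ⟨fun j => ?_, ?_⟩
  · have h1 := mul_le_mul_of_nonneg_left (hr.1 j) (sub_nonneg.2 hs1)
    have h2 := mul_le_mul_of_nonneg_left (hp.1 j) hs0
    rw [hq]; nlinarith
  · have : ∑ j, q j = (1 - s) * ∑ j, r j + s * ∑ j, p j := by
      rw [Finset.mul_sum, Finset.mul_sum, ← Finset.sum_add_distrib]
      refine Finset.sum_congr rfl fun j _ => ?_
      rw [hq]; ring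
    rw [this]
    have h1 := mul_le_mul_of_nonneg_left hr.2 (sub_nonneg.2 hs1)
    have h2 := mul_le_mul_of_nonneg_left hp.2 hs0
    nlinarith

/-- family of local solutions -/
def Fam {n : ℕ} (F : Fin n → (Fin n → ℂ) → ℂ) (D τ σ : ℝ)
    (u : (Fin n → ℝ) → (Fin n → ℂ) → ℂ) : Prop :=
  ∀ r, Adm τ σ r → ContDiffOn ℝ 1 (u r) (PD r) ∧ (∀ j, ∀ z ∈ PD r, db j (u r) z = F j z) ∧
    ∀ z ∈ PD r, ‖u r z‖ ≤ D

lemma fam_diff {n : ℕ} {F : Fin n → (Fin n → ℂ) → ℂ} {D τ σ : ℝ}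
    {u : (Fin n → ℝ) → (Fin n → ℂ) → ℂ} (hu : Fam F D τ σ u) {r s t : Fin n → ℝ}
    (hr : Adm τ σ r) (hs : Adm τ σ s) (htr : ∀ j, t j ≤ r j) (hts : ∀ j, t j ≤ s j) :
    DifferentiableOn ℂ (fun z => u r z - u s z) (PD t) ∧
      ∀ z ∈ PD t, ‖u r z - u s z‖ ≤ 2 * D := by
  have m1 : ∀ z ∈ PD t, z ∈ PD r := fun z hz j => (hz j).trans_le (htr j)
  have m2 : ∀ z ∈ PD t, z ∈ PD s := fun z hz j => (hz j).trans_le (hts j)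
  obtain ⟨a1, a2, a3⟩ := hu r hr
  obtain ⟨b1, b2, b3⟩ := hu s hs
  constructor
  · intro z hz
    apply DifferentiableAt.differentiableWithinAt
    have d1 : DifferentiableAt ℝ (u r) z :=
      (a1.contDiffAt ((isOpen_PD r).mem_nhds (m1 z hz))).differentiableAt (by norm_num)
    have d2 : DifferentiableAt ℝ (u s) z :=
      (b1.contDiffAt ((isOpen_PD s).mem_nhds (m2 z hz))).differentiableAt (by norm_num)
    apply complex_of_dbar (d1.fun_sub d2)
    intro ξ
    rw [dbar_sub _ _ _ _ d1 d2, dbar_eq_sum, dbar_eq_sum, ← Finset.sum_sub_distrib]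
    refine Finset.sum_eq_zero fun j _ => ?_
    rw [a2 j z (m1 z hz), b2 j z (m2 z hz), sub_self]
  · intro z hz
    have := norm_sub_le (u r z) (u s z)
    have := a3 z (m1 z hz)
    have := b3 z (m2 z hz)
    linarith

lemma fam_coef {n : ℕ} {F : Fin n → (Fin n → ℂ) → ℂ} {D τ σ : ℝ} (hτ : 0 < τ)
    {u : (Fin n → ℝ) → (Fin n → ℂ) → ℂ} (hu : Fam F D τ σ u) {r s p : Fin n → ℝ}
    (hr : Adm τ σ r) (hs : Adm τ σ s) (hp : Adm τ σ p) (k : Fin n → ℕ) :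
    coef n (fun z => u r z - u s z) k =
      coef n (fun z => u r z - u p z) k - coef n (fun z => u s z - u p z) k := by
  obtain ⟨h1, h2⟩ := fam_diff hu (t := fun _ => τ) hr hp hr.1 hp.1
  obtain ⟨h3, h4⟩ := fam_diff hu (t := fun _ => τ) hs hp hs.1 hp.1
  exact coef_sub (fun _ => hτ) h1 h2 h3 h4 (fun z _ => by ring) k

lemma glue_est {n : ℕ} {F : Fin n → (Fin n → ℂ) → ℂ} {D τ σ a lam ρ dl κ : ℝ} {L : ℕ}
    (hτ : 0 < τ) (hD : 0 ≤ D) (ha : 0 < a) (hlam : 0 < lam) (hla : lam * ρ ≤ a)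
    (hs : a + n * τ ≤ σ) (hσ : σ ≤ 1) (hdl : 0 < dl) (hκ : κ = (1 + dl) / lam)
    (hL : 0 < L) (hL1 : 1 / (L : ℝ) ≤ dl * τ)
    {u : (Fin n → ℝ) → (Fin n → ℂ) → ℂ} (hu : Fam F D τ σ u) {r : Fin n → ℝ}
    (hr : Adm τ σ r) (k : Fin n → ℕ) {z : Fin n → ℂ} (hz : ∑ j, ‖z j‖ ≤ ρ)
    (hzr : ∀ j, lam * ‖z j‖ ≤ r j) :
    ‖coef n (fun z => u r z - u (pk a τ k) z) k * ∏ j, z j ^ k j‖ ≤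
      2 * L * D * ∏ j, κ ^ k j := by
  set p := pk a τ k with hpdef
  have hp : Adm τ σ p := adm_pk ha hs k
  set q : ℕ → Fin n → ℝ := fun i j => r j + ((i : ℝ) / L) * (p j - r j) with hq
  have hLr : (0:ℝ) < L := by exact_mod_cast hL
  have hsi : ∀ i ≤ L, 0 ≤ (i : ℝ) / L ∧ (i : ℝ) / L ≤ 1 := fun i hi =>
    ⟨by positivity, (div_le_one hLr).2 (by exact_mod_cast hi)⟩
  have hqa : ∀ i ≤ L, Adm τ σ (q i) := fun i hi =>
    hr.seg hp (hsi i hi).1 (hsi i hi).2 (fun j => rfl)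
  have hq0 : q 0 = r := by ext j; simp [hq]
  have hqL : q L = p := by ext j; simp [hq, hLr.ne']
  set c : ℕ → ℂ := fun i => coef n (fun z => u (q i) z - u p z) k with hc
  have hcL : c L = 0 := by
    have := fam_coef hτ hu hp hp hp k
    rw [sub_self] at this
    simp only [hc, hqL]
    exact this
  set X : ℝ := ∏ j, ‖z j‖ ^ k j with hX
  have hX0 : 0 ≤ X := Finset.prod_nonneg fun j _ => pow_nonneg (norm_nonneg _) _
  have hκ0 : 0 < κ := by rw [hκ]; positivity
  have hstep : ∀ i < L, ‖c i - c (i+1)‖ * X ≤ 2 * D * ∏ j, κ ^ k j := by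
    intro i hi
    have hA1 := hqa i hi.le
    have hA2 := hqa (i+1) hi
    set t : Fin n → ℝ := fun j => min (q i j) (q (i+1) j) with ht
    have htpos : ∀ j, 0 < t j := fun j => lt_min (hτ.trans_le (hA1.1 j)) (hτ.trans_le (hA2.1 j))
    obtain ⟨g1, g2⟩ := fam_diff hu (t := t) hA1 hA2 (fun j => min_le_left _ _)
      (fun j => min_le_right _ _)
    have h1 := coef_bound htpos g1 g2 k
    rw [fam_coef hτ hu hA1 hA2 hp k] at h1
    change ‖c i - c (i+1)‖ * _ ≤ _ at h1
    have h2 := key_ineq (x := fun j => lam * ‖z j‖) (q := q i) (r := r) (p := p) (k := k) (a := a)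
      (τ := τ) (s := (i:ℝ)/L) ha hτ.le (hsi i hi.le).1 (hsi i hi.le).2
      (fun j => by positivity)
      (by rw [← Finset.mul_sum]; exact (mul_le_mul_of_nonneg_left hz hlam.le).trans hla) hzr
      (fun j => rfl) (fun j => rfl)
    have h3 : ∀ j, q i j ≤ (1 + dl) * t j := by
      intro j
      have hb1 : 0 < q i j := hτ.trans_le (hA1.1 j)
      rw [ht]
      rw [mul_min_of_nonneg _ _ (by positivity)]
      apply le_min
      · nlinarith
      · have e : q i j - q (i+1) j = (r j - p j) * (1 / L) := by
          simp only [hq]; push_cast; field_simp; ring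
        have hr1 : r j ≤ 1 := by
          refine le_trans ?_ (hr.2.trans hσ)
          exact Finset.single_le_sum (f := r) (fun i _ => hτ.le.trans (hr.1 i)) (Finset.mem_univ j)
        have hpj := hp.1 j
        have e2 : (r j - p j) * (1 / L) ≤ 1 * (1 / L) :=
          mul_le_mul_of_nonneg_right (by linarith) (by positivity)
        have e3 := mul_le_mul_of_nonneg_left (hA2.1 j) hdl.le
        nlinarith
    have h4 : ∏ j, (lam * ‖z j‖) ^ k j ≤ ∏ j, ((1 + dl) * t j) ^ k j :=
      h2.trans (Finset.prod_le_prod (fun j _ => pow_nonneg (hτ.le.trans (hA1.1 j)) _)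
        (fun j _ => pow_le_pow_left₀ (hτ.le.trans (hA1.1 j)) (h3 j) _))
    have h5 : X ≤ (∏ j, κ ^ k j) * ∏ j, t j ^ k j := by
      have e1 : X = (∏ j, (lam⁻¹) ^ k j) * ∏ j, (lam * ‖z j‖) ^ k j := by
        rw [← Finset.prod_mul_distrib, hX]
        refine Finset.prod_congr rfl fun j _ => ?_
        rw [← mul_pow]; congr 1; field_simp
      have e2 : (∏ j, κ ^ k j) * ∏ j, t j ^ k j =
          (∏ j, (lam⁻¹) ^ k j) * ∏ j, ((1 + dl) * t j) ^ k j := by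
        rw [← Finset.prod_mul_distrib, ← Finset.prod_mul_distrib]
        refine Finset.prod_congr rfl fun j _ => ?_
        rw [← mul_pow, ← mul_pow, hκ]; congr 1; field_simp
      rw [e1, e2]
      exact mul_le_mul_of_nonneg_left h4 (Finset.prod_nonneg fun j _ => by positivity)
    have hK0 : 0 ≤ ∏ j, κ ^ k j := Finset.prod_nonneg fun j _ => by positivity
    calc ‖c i - c (i+1)‖ * X ≤ ‖c i - c (i+1)‖ * ((∏ j, κ ^ k j) * ∏ j, t j ^ k j) :=
          mul_le_mul_of_nonneg_left h5 (norm_nonneg _)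
      _ = (‖c i - c (i+1)‖ * ∏ j, t j ^ k j) * (∏ j, κ ^ k j) := by ring
      _ ≤ _ := mul_le_mul_of_nonneg_right h1 hK0
  have hc0 : coef n (fun z => u r z - u p z) k = c 0 := by simp only [hc, hq0]
  have htel : c 0 = ∑ i ∈ Finset.range L, (c i - c (i+1)) := by
    rw [Finset.sum_range_sub', hcL, sub_zero]
  rw [hc0, norm_mul, norm_prod]
  simp only [norm_pow]
  change ‖c 0‖ * X ≤ _
  calc ‖c 0‖ * X ≤ (∑ i ∈ Finset.range L, ‖c i - c (i+1)‖) * X := by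
        rw [htel]; exact mul_le_mul_of_nonneg_right (norm_sum_le _ _) hX0
    _ = ∑ i ∈ Finset.range L, ‖c i - c (i+1)‖ * X := Finset.sum_mul _ _ _
    _ ≤ ∑ i ∈ Finset.range L, 2 * D * ∏ j, κ ^ k j :=
        Finset.sum_le_sum fun i hi => hstep i (Finset.mem_range.1 hi)
    _ = _ := by simp; ring


lemma glue {n : ℕ} {F : Fin n → (Fin n → ℂ) → ℂ} {D τ σ a lam ρ dl κ : ℝ} {L : ℕ}
    (hτ : 0 < τ) (hD : 0 ≤ D) (ha : 0 < a) (hlam : 1 ≤ lam) (hla : lam * ρ ≤ a)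
    (hs : a + n * τ ≤ σ) (hσ : σ ≤ 1) (hdl : 0 < dl) (hκ : κ = (1 + dl) / lam) (hκ1 : κ < 1)
    (hL : 0 < L) (hL1 : 1 / (L : ℝ) ≤ dl * τ)
    {u : (Fin n → ℝ) → (Fin n → ℂ) → ℂ} (hu : Fam F D τ σ u) :
    ∃ w : (Fin n → ℂ) → ℂ, ContDiffOn ℝ 1 w (BL n ρ) ∧
      (∀ j, ∀ z ∈ BL n ρ, db j w z = F j z) ∧
      ∀ z ∈ BL n ρ, ‖w z‖ ≤ D + 2 * L * D * ((1 - κ)⁻¹) ^ n := by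
  have hlam0 : 0 < lam := by linarith
  have hκ0 : 0 < κ := by rw [hκ]; positivity
  set cf : (Fin n → ℝ) → (Fin n → ℕ) → ℂ :=
    fun r k => coef n (fun z => u r z - u (pk a τ k) z) k with hcf
  set h : (Fin n → ℝ) → (Fin n → ℂ) → ℂ := fun r z => ∑' k, cf r k * ∏ j, z j ^ k j with hh
  set U : (Fin n → ℝ) → Set (Fin n → ℂ) := fun r => {z | z ∈ BL n ρ ∧ ∀ j, lam * ‖z j‖ < r j}
    with hU
  have hUo : ∀ r, IsOpen (U r) := by
    intro r
    have : U r = BL n ρ ∩ ⋂ j, {z : Fin n → ℂ | lam * ‖z j‖ < r j} := by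
      ext z; simp [hU]
    rw [this]
    exact (isOpen_BL n ρ).inter
      (isOpen_iInter_of_finite fun j => isOpen_lt (by fun_prop) (by fun_prop))
  have hUPD : ∀ r, ∀ z ∈ U r, z ∈ PD r := by
    intro r z hz j
    have h1 := hz.2 j
    have h2 := norm_nonneg (z j)
    nlinarith
  have hest : ∀ r, Adm τ σ r → ∀ k, ∀ z ∈ U r, ‖cf r k * ∏ j, z j ^ k j‖ ≤
      2 * L * D * ∏ j, κ ^ k j := by
    intro r hr k z hz
    exact glue_est hτ hD ha hlam0 hla hs hσ hdl hκ hL hL1 hu hr k (le_of_lt hz.1)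
      (fun j => (hz.2 j).le)
  have hgeo := (hasSum_geom (n := n) (x := fun _ => κ) (fun _ => hκ0.le) (fun _ => hκ1)).mul_left
    (2 * L * D)
  simp only [Finset.prod_const, Finset.card_univ, Fintype.card_fin] at hgeo
  have hsm : ∀ r, Adm τ σ r → ∀ z ∈ U r, Summable (fun k => cf r k * ∏ j, z j ^ k j) :=
    fun r hr z hz => Summable.of_norm_bounded hgeo.summable (fun k => hest r hr k z hz)
  have hbd : ∀ r, Adm τ σ r → ∀ z ∈ U r, ‖h r z‖ ≤ 2 * L * D * ((1 - κ)⁻¹) ^ n := by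
    intro r hr z hz
    exact tsum_of_norm_bounded hgeo (fun k => hest r hr k z hz)
  have hhol : ∀ r, Adm τ σ r → ContDiffOn ℂ 1 (h r) (U r) := by
    intro r hr
    apply holo_tsum (hUo r) _ _ hgeo.summable _ (hest r hr)
    intro k
    fun_prop
  have hind : ∀ r s, Adm τ σ r → Adm τ σ s → ∀ z ∈ U r, z ∈ U s →
      u r z - h r z = u s z - h s z := by
    intro r s hr hs' z hz1 hz2
    obtain ⟨g1, g2⟩ := fam_diff hu (t := fun j => min (r j) (s j)) hr hs'
      (fun j => min_le_left _ _) (fun j => min_le_right _ _)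
    have h1 := coef_hasSum (fun j => lt_min (hτ.trans_le (hr.1 j)) (hτ.trans_le (hs'.1 j))) g1 g2 z
      (fun j => lt_min (hUPD r z hz1 j) (hUPD s z hz2 j))
    have h2 := (hsm r hr z hz1).hasSum.sub (hsm s hs' z hz2).hasSum
    have e : (fun k => coef n (fun z => u r z - u s z) k * ∏ j, z j ^ k j) =
        fun k => cf r k * ∏ j, z j ^ k j - cf s k * ∏ j, z j ^ k j := by
      ext k
      rw [fam_coef hτ hu hr hs' (adm_pk ha hs k) k, sub_mul]
    rw [e] at h1
    have h3 := h1.unique h2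
    simp only [hh]
    linear_combination h3
  set rz : (Fin n → ℂ) → Fin n → ℝ := fun z j => lam * ‖z j‖ + τ with hrz
  have hrzA : ∀ z ∈ BL n ρ, Adm τ σ (rz z) := by
    intro z hz
    refine ⟨fun j => ?_, ?_⟩
    · simp only [hrz]
      have := norm_nonneg (z j)
      have := mul_nonneg hlam0.le this
      linarith
    · refine le_trans ?_ hs
      simp only [hrz, Finset.sum_add_distrib, ← Finset.mul_sum, Finset.sum_const, Finset.card_univ,
        Fintype.card_fin, nsmul_eq_mul]
      have : lam * ∑ j, ‖z j‖ ≤ lam * ρ := mul_le_mul_of_nonneg_left (le_of_lt hz) hlam0.le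
      linarith
  have hzU : ∀ z ∈ BL n ρ, z ∈ U (rz z) := fun z hz => ⟨hz, fun j => by simp only [hrz]; linarith⟩
  have hloc : ∀ z0 ∈ BL n ρ, (fun z => u (rz z) z - h (rz z) z) =ᶠ[nhds z0]
      (fun z => u (rz z0) z - h (rz z0) z) := by
    intro z0 hz0
    filter_upwards [(hUo (rz z0)).mem_nhds (hzU z0 hz0)] with z hz
    exact hind _ _ (hrzA z hz.1) (hrzA z0 hz0) z (hzU z hz.1) hz
  have hC : ∀ z0 ∈ BL n ρ, ContDiffAt ℝ 1 (u (rz z0)) z0 := fun z0 hz0 =>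
    (hu _ (hrzA z0 hz0)).1.contDiffAt ((isOpen_PD _).mem_nhds (hUPD _ _ (hzU z0 hz0)))
  have hC2 : ∀ z0 ∈ BL n ρ, ContDiffAt ℂ 1 (h (rz z0)) z0 := fun z0 hz0 =>
    (hhol _ (hrzA z0 hz0)).contDiffAt ((hUo _).mem_nhds (hzU z0 hz0))
  refine ⟨fun z => u (rz z) z - h (rz z) z, ?_, ?_, ?_⟩
  · intro z0 hz0
    apply ContDiffAt.contDiffWithinAt
    exact ((hC z0 hz0).sub ((hC2 z0 hz0).restrict_scalars ℝ)).congr_of_eventuallyEq (hloc z0 hz0)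
  · intro j z0 hz0
    have d1 : DifferentiableAt ℝ (u (rz z0)) z0 := (hC z0 hz0).differentiableAt (by norm_num)
    have d2 : DifferentiableAt ℂ (h (rz z0)) z0 := (hC2 z0 hz0).differentiableAt (by norm_num)
    rw [db, dbar_congr (hloc z0 hz0), dbar_sub _ _ _ _ d1 (d2.restrictScalars ℝ),
      dbar_of_complex d2, sub_zero]
    exact (hu _ (hrzA z0 hz0)).2.1 j z0 (hUPD _ _ (hzU z0 hz0))
  · intro z hz
    have h1 := (hu _ (hrzA z hz)).2.2 z (hUPD _ _ (hzU z hz))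
    have h2 := hbd _ (hrzA z hz) z (hzU z hz)
    exact (norm_sub_le _ _).trans (add_le_add h1 h2)

lemma ball_solve (ρ : ℝ) (hρ0 : 0 < ρ) (hρ1 : ρ < 1) : ∃ C : ℝ, 1 ≤ C ∧ ∀ (n : ℕ)
    (F : Fin n → (Fin n → ℂ) → ℂ) (M : ℝ), 0 ≤ M →
      (∀ j, ContDiffOn ℝ 1 (F j) (BL n 1)) →
      (∀ i j, ∀ z ∈ BL n 1, db i (F j) z = db j (F i) z) →
      (∀ j, ∀ z ∈ BL n 1, ‖F j z‖ ≤ M) →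
      ∃ u : (Fin n → ℂ) → ℂ, ContDiffOn ℝ 1 u (BL n ρ) ∧
        (∀ j, ∀ z ∈ BL n ρ, db j u z = F j z) ∧
        (∀ z ∈ BL n ρ, ‖u z‖ ≤ C ^ n * M) := by
  set a : ℝ := (1 + ρ) / 2 with ha
  set lam : ℝ := a / ρ with hlam
  set σ : ℝ := (1 + a) / 2 with hσ
  set η : ℝ := (1 - a) / 2 with hη
  set δ : ℝ := (1 - σ) / (2 * σ) with hδ
  set dl : ℝ := (lam - 1) / 2 with hdl
  set κ : ℝ := (1 + dl) / lam with hκ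
  have ha0 : 0 < a := by rw [ha]; linarith
  have ha1 : a < 1 := by rw [ha]; linarith
  have haρ : ρ < a := by rw [ha]; linarith
  have hlam1 : 1 < lam := by rw [hlam, lt_div_iff₀ hρ0]; linarith
  have hσ0 : 0 < σ := by rw [hσ]; linarith
  have hσ1 : σ < 1 := by rw [hσ]; linarith
  have hη0 : 0 < η := by rw [hη]; linarith
  have hδ0 : 0 < δ := by rw [hδ]; exact div_pos (by linarith) (by linarith)
  have hdl0 : 0 < dl := by rw [hdl]; linarith
  have hκ1 : κ < 1 := by rw [hκ, div_lt_one (by linarith), hdl]; linarith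
  have hδσ : (1 + δ) * σ < 1 := by
    have : (1 + δ) * σ = σ + (1 - σ) / 2 := by rw [hδ]; field_simp
    rw [this]; linarith
  obtain ⟨A, hA1, hA⟩ := poly_solve_r δ hδ0
  set c : ℝ := 1 / (dl * η) + 1 with hc
  have hc1 : 1 ≤ c := by
    have : 0 < 1 / (dl * η) := by positivity
    rw [hc]; linarith
  have hκi : 1 ≤ (1 - κ)⁻¹ := by
    have : 0 < κ := by rw [hκ]; positivity
    exact (one_le_inv₀ (by linarith)).2 (by linarith)
  set C : ℝ := (1 + 2 * c) * (A * 2 * (1 - κ)⁻¹) with hC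
  have hAk : 1 ≤ A * 2 * (1 - κ)⁻¹ := by nlinarith
  refine ⟨C, by rw [hC]; nlinarith, ?_⟩
  intro n F M hM hF hcl hb
  rcases Nat.eq_zero_or_pos n with hn | hn
  · subst hn
    refine ⟨fun _ => 0, contDiffOn_const, fun j => j.elim0, fun z _ => ?_⟩
    simpa using hM
  have hn0 : (0:ℝ) < n := by exact_mod_cast hn
  set τ : ℝ := η / n with hτ
  have hτ0 : 0 < τ := by positivity
  set L : ℕ := ⌈1 / (dl * τ)⌉₊ with hL
  have hL0 : 0 < L := Nat.ceil_pos.2 (by positivity)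
  have hL1 : 1 / (L : ℝ) ≤ dl * τ := by
    rw [div_le_iff₀ (by exact_mod_cast hL0)]
    have : 1 / (dl * τ) ≤ L := Nat.le_ceil _
    rw [div_le_iff₀ (by positivity)] at this
    linarith
  have hL2 : (L : ℝ) ≤ c * 2 ^ n := by
    have h1 : (L : ℝ) < 1 / (dl * τ) + 1 := Nat.ceil_lt_add_one (by positivity)
    have h2 : 1 / (dl * τ) = 1 / (dl * η) * n := by rw [hτ]; field_simp
    have h3 : (n : ℝ) ≤ 2 ^ n := by exact_mod_cast Nat.lt_two_pow_self.le
    have h4 : (1 : ℝ) ≤ 2 ^ n := one_le_pow₀ (by norm_num)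
    have h5 : 0 < 1 / (dl * η) := by positivity
    rw [h2] at h1
    rw [hc]
    nlinarith
  have hex : ∀ r : Fin n → ℝ, ∃ u : (Fin n → ℂ) → ℂ, Adm τ σ r → ContDiffOn ℝ 1 u (PD r) ∧
      (∀ j, ∀ z ∈ PD r, db j u z = F j z) ∧ ∀ z ∈ PD r, ‖u z‖ ≤ A ^ n * M := by
    intro r
    by_cases hr : Adm τ σ r
    · have hex2 := hA n F M hM hF hcl hb r (fun j => hτ0.trans_le (hr.1 j))
        (lt_of_le_of_lt (mul_le_mul_of_nonneg_left hr.2 (by linarith)) hδσ)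
      obtain ⟨u, hu⟩ := hex2
      exact ⟨u, fun _ => hu⟩
    · exact ⟨fun _ => 0, fun h => absurd h hr⟩
  choose u hu using hex
  have hAn : 1 ≤ A ^ n := one_le_pow₀ hA1
  obtain ⟨w, hw1, hw2, hw3⟩ := glue (F := F) (D := A ^ n * M) (τ := τ) (σ := σ) (a := a)
    (lam := lam) (ρ := ρ) (dl := dl) (κ := κ) (L := L) hτ0 (by positivity) ha0 hlam1.le
    (by rw [hlam]; field_simp; exact le_rfl)
    (by rw [hτ, hσ, hη]; field_simp; linarith) hσ1.le hdl0 rfl hκ1 hL0 hL1 (u := u) hu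
  refine ⟨w, hw1, hw2, fun z hz => (hw3 z hz).trans ?_⟩
  have e0 : 1 ≤ ((1 - κ)⁻¹) ^ n := one_le_pow₀ hκi
  have e1 : (1 + 2 * c) ≤ (1 + 2 * c) ^ n := le_self_pow₀ (by linarith) hn.ne'
  have e2 : (1:ℝ) ≤ 2 ^ n := one_le_pow₀ (by norm_num)
  have hAM : 0 ≤ A ^ n * M := by positivity
  rw [hC, mul_pow, mul_pow, mul_pow]
  set K := ((1 - κ)⁻¹) ^ n with hK
  have e3 : A ^ n * M ≤ A ^ n * M * (2 ^ n * K) := le_mul_of_one_le_right hAM (by nlinarith)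
  have e4 : 2 * L * (A ^ n * M) * K ≤ 2 * (c * 2 ^ n) * (A ^ n * M) * K := by
    gcongr
  calc A ^ n * M + 2 * L * (A ^ n * M) * K
      ≤ A ^ n * M * (2 ^ n * K) + 2 * (c * 2 ^ n) * (A ^ n * M) * K := add_le_add e3 e4
    _ = (1 + 2 * c) * (A ^ n * 2 ^ n * K * M) := by ring
    _ ≤ (1 + 2 * c) ^ n * (A ^ n * 2 ^ n * K * M) :=
        mul_le_mul_of_nonneg_right e1 (by positivity)
    _ = _ := by ring


/-- coordinate projection -/
def prT {N : ℕ} (T : Finset (Fin N)) : EN N →L[ℂ] EN N :=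
  ((PiLp.continuousLinearEquiv 1 ℂ (fun _ : Fin N => ℂ)).symm.toContinuousLinearMap).comp
    (ContinuousLinearMap.pi fun i => if i ∈ T then
      (ContinuousLinearMap.proj i : (Fin N → ℂ) →L[ℂ] ℂ).comp
        (PiLp.continuousLinearEquiv 1 ℂ (fun _ : Fin N => ℂ)).toContinuousLinearMap else 0)

lemma prT_apply {N : ℕ} (T : Finset (Fin N)) (z : EN N) (i : Fin N) :
    prT T z i = if i ∈ T then z i else 0 := by
  simp only [prT, ContinuousLinearMap.comp_apply]
  by_cases h : i ∈ T <;> simp [h]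

/-- inclusion -/
def inT {N : ℕ} (T : Finset (Fin N)) (R : ℝ) : (Fin T.card → ℂ) →L[ℂ] EN N :=
  ((PiLp.continuousLinearEquiv 1 ℂ (fun _ : Fin N => ℂ)).symm.toContinuousLinearMap).comp
    (ContinuousLinearMap.pi fun i => if h : i ∈ T then
      (R : ℂ) • (ContinuousLinearMap.proj (T.equivFin ⟨i, h⟩) : (Fin T.card → ℂ) →L[ℂ] ℂ) else 0)

lemma inT_apply {N : ℕ} (T : Finset (Fin N)) (R : ℝ) (w : Fin T.card → ℂ) (i : Fin N) :
    inT T R w i = if h : i ∈ T then R * w (T.equivFin ⟨i, h⟩) else 0 := by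
  simp only [inT, ContinuousLinearMap.comp_apply]
  by_cases h : i ∈ T <;> simp [h]

/-- restriction -/
def reT {N : ℕ} (T : Finset (Fin N)) (R : ℝ) : EN N →L[ℂ] (Fin T.card → ℂ) :=
  (ContinuousLinearMap.pi fun j => ((R⁻¹ : ℝ) : ℂ) •
    (ContinuousLinearMap.proj ((T.equivFin.symm j : T) : Fin N) : (Fin N → ℂ) →L[ℂ] ℂ)).comp
    (PiLp.continuousLinearEquiv 1 ℂ (fun _ : Fin N => ℂ)).toContinuousLinearMap

lemma reT_apply {N : ℕ} (T : Finset (Fin N)) (R : ℝ) (z : EN N) (j : Fin T.card) :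
    reT T R z j = ((R⁻¹ : ℝ) : ℂ) * z (T.equivFin.symm j : T) := by
  simp [reT, ContinuousLinearMap.comp_apply]

lemma in_re {N : ℕ} (T : Finset (Fin N)) {R : ℝ} (hR : 0 < R) (z : EN N) :
    inT T R (reT T R z) = prT T z := by
  ext i
  rw [inT_apply, prT_apply]
  by_cases h : i ∈ T
  · simp only [h, dif_pos, if_true, reT_apply, Equiv.symm_apply_apply]
    have : (R : ℂ) ≠ 0 := by exact_mod_cast hR.ne'
    push_cast; field_simp
  · simp [h]

lemma EN_norm {N : ℕ} (z : EN N) : ‖z‖ = ∑ i, ‖z i‖ := by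
  have := PiLp.norm_eq_of_nat 1 (by simp) z
  simpa using this

lemma norm_inT {N : ℕ} (T : Finset (Fin N)) {R : ℝ} (hR : 0 < R) (w : Fin T.card → ℂ) :
    ‖inT T R w‖ = R * ∑ j, ‖w j‖ := by
  rw [EN_norm]
  have h1 : ∑ i, ‖inT T R w i‖ = ∑ i ∈ T, ‖inT T R w i‖ := by
    symm
    apply Finset.sum_subset (Finset.subset_univ _)
    intro i _ hi
    rw [inT_apply]; simp [hi]
  rw [h1, ← Finset.sum_coe_sort, Finset.mul_sum]
  apply Fintype.sum_equiv T.equivFin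
  intro i
  rw [inT_apply]
  simp [abs_of_pos hR]

lemma norm_prT {N : ℕ} (T : Finset (Fin N)) (z : EN N) : ‖prT T z‖ ≤ ‖z‖ := by
  rw [EN_norm, EN_norm]
  refine Finset.sum_le_sum fun i _ => ?_
  rw [prT_apply]; split_ifs <;> simp

lemma sum_reT {N : ℕ} (T : Finset (Fin N)) {R : ℝ} (hR : 0 < R) (z : EN N) :
    R * ∑ j, ‖reT T R z j‖ ≤ ‖z‖ := by
  rw [← norm_inT T hR, in_re T hR]; exact norm_prT T z

lemma prT_prT {N : ℕ} {T U : Finset (Fin N)} (h : U ⊆ T) (z : EN N) :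
    prT T (prT U z) = prT U z := by
  ext i
  rw [prT_apply, prT_apply]
  by_cases hi : i ∈ U
  · simp [hi, h hi]
  · simp [hi]

lemma flip_sum {α : Type*} [DecidableEq α] (s : Finset (Finset α)) (i : α) (F : Finset α → ℂ)
    (h : ∀ U ∈ s, symmDiff U {i} ∈ s) (hF : ∀ U ∈ s, F (symmDiff U {i}) = F U) :
    ∑ U ∈ s, (-1) ^ U.card * F U = 0 := by
  have hsg : ∀ U : Finset α, ((-1 : ℂ)) ^ (symmDiff U {i}).card = - (-1) ^ U.card := by
    intro U
    by_cases hi : i ∈ U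
    · have e : symmDiff U {i} = U.erase i := by
        ext x; simp only [Finset.mem_symmDiff, Finset.mem_singleton, Finset.mem_erase]
        by_cases hx : x = i <;> simp [hx, hi]
      rw [e, ← Finset.card_erase_add_one hi, pow_succ]; ring
    · have e : symmDiff U {i} = insert i U := by
        ext x; simp only [Finset.mem_symmDiff, Finset.mem_singleton, Finset.mem_insert]
        by_cases hx : x = i <;> simp [hx, hi]
      rw [e, Finset.card_insert_of_notMem hi, pow_succ]; ring
  refine Finset.sum_involution (fun U _ => symmDiff U {i}) ?_ ?_ h ?_
  · intro U hU
    rw [hsg, hF U hU]; ring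
  · intro U hU _ he
    have := hsg U
    rw [he] at this
    have h2 : ((-1 : ℂ)) ^ U.card ≠ 0 := pow_ne_zero _ (by norm_num)
    exact h2 (self_eq_neg.1 this)
  · intro U hU
    exact symmDiff_symmDiff_cancel_right _ _

lemma sub_solve {N : ℕ} {ρ C R M : ℝ} (hR : 0 < R) (hM : 0 ≤ M)
    (hsol : ∀ (n : ℕ)
    (F : Fin n → (Fin n → ℂ) → ℂ) (M : ℝ), 0 ≤ M →
      (∀ j, ContDiffOn ℝ 1 (F j) (BL n 1)) →
      (∀ i j, ∀ z ∈ BL n 1, db i (F j) z = db j (F i) z) →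
      (∀ j, ∀ z ∈ BL n 1, ‖F j z‖ ≤ M) →
      ∃ u : (Fin n → ℂ) → ℂ, ContDiffOn ℝ 1 u (BL n ρ) ∧
        (∀ j, ∀ z ∈ BL n ρ, db j u z = F j z) ∧
        (∀ z ∈ BL n ρ, ‖u z‖ ≤ C ^ n * M))
    (hρ1 : ρ < 1)
    {f : EN N → EN N → ℂ} (hf : IsForm01 1 {z : EN N | ‖z‖ < R} f)
    (hcl : DbarClosed {z : EN N | ‖z‖ < R} f)
    (hb : ∀ z : EN N, ‖z‖ < R → ∀ ξ : EN N, ‖ξ‖ ≤ 1 → ‖f z ξ‖ ≤ M) (T : Finset (Fin N)) :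
    ∃ g : EN N → ℂ, ContDiffOn ℝ 1 g {z : EN N | ‖z‖ < ρ * R} ∧
      (∀ z : EN N, ‖z‖ < ρ * R → ∀ ξ, dbar g z ξ = f (prT T z) (prT T ξ)) ∧
      ∀ z : EN N, ‖z‖ < ρ * R → ‖g z‖ ≤ C ^ T.card * (R * M) := by
  obtain ⟨hf1, hf2, hf3⟩ := hf
  have hop : IsOpen {z : EN N | ‖z‖ < R} := isOpen_lt continuous_norm continuous_const
  have hmap : ∀ w ∈ BL T.card 1, ‖inT T R w‖ < R := by
    intro w hw
    rw [norm_inT T hR]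
    have : ∑ j, ‖w j‖ < 1 := hw
    nlinarith
  have hfξ : ∀ ξ : EN N, ContDiffOn ℝ 1 (fun z => f z ξ) {z : EN N | ‖z‖ < R} := by
    intro ξ
    exact hf3.comp (g := fun p : EN N × EN N => f p.1 p.2) (f := fun z => (z, ξ))
      (by fun_prop) (fun z hz => ⟨hz, mem_univ _⟩)
  have hdξ : ∀ ξ : EN N, ∀ z : EN N, ‖z‖ < R → DifferentiableAt ℝ (fun z => f z ξ) z :=
    fun ξ z hz => ((hfξ ξ).contDiffAt (hop.mem_nhds hz)).differentiableAt (by norm_num)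
  have hiC : ContDiff ℝ 1 (fun w => inT T R w) := ((inT T R).restrictScalars ℝ).contDiff
  have hrC : ContDiff ℝ 1 (fun w => reT T R w) := ((reT T R).restrictScalars ℝ).contDiff
  have hex := hsol T.card (fun j w => f (inT T R w) (inT T R (Pi.single j 1))) (R * M)
    (by positivity)
    (fun j => (hfξ _).comp hiC.contDiffOn hmap)
    (by
      intro i j w hw
      rw [db, db, dbar_comp (inT T R) (fun z => f z (inT T R (Pi.single j 1))) w _
        (hdξ _ _ (hmap w hw)), dbar_comp (inT T R) (fun z => f z (inT T R (Pi.single i 1))) w _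
        (hdξ _ _ (hmap w hw))]
      exact hcl _ (hmap w hw) _ _)
    (by
      intro j w hw
      have hn : ‖inT T R (Pi.single j 1)‖ = R := by
        rw [norm_inT T hR, Finset.sum_eq_single j]
        · simp
        · intro b _ hb; simp [hb]
        · simp
      have e : inT T R (Pi.single j 1) =
          (R : ℂ) • (((R⁻¹ : ℝ) : ℂ) • inT T R (Pi.single j 1)) := by
        rw [smul_smul, ← Complex.ofReal_mul, mul_inv_cancel₀ hR.ne']; simp
      rw [e, hf2 _ (hmap w hw), norm_mul]
      have h1 : ‖(starRingEnd ℂ) (R : ℂ)‖ = R := by simp [abs_of_pos hR]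
      rw [h1]
      refine mul_le_mul_of_nonneg_left (hb _ (hmap w hw) _ ?_) hR.le
      rw [norm_smul, hn, Complex.norm_real, Real.norm_of_nonneg (inv_nonneg.2 hR.le),
        inv_mul_cancel₀ hR.ne'])
  obtain ⟨v, hv1, hv2, hv3⟩ := hex
  have hre : ∀ z : EN N, ‖z‖ < ρ * R → reT T R z ∈ BL T.card ρ := by
    intro z hz
    have h1 := sum_reT T hR z
    change ∑ j, ‖reT T R z j‖ < ρ
    by_contra hcon
    nlinarith [not_lt.1 hcon]
  refine ⟨fun z => v (reT T R z), hv1.comp hrC.contDiffOn hre, ?_, fun z hz => hv3 _ (hre z hz)⟩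
  intro z hz ξ
  have hdv : DifferentiableAt ℝ v (reT T R z) :=
    (hv1.contDiffAt ((isOpen_BL _ _).mem_nhds (hre z hz))).differentiableAt (by norm_num)
  rw [dbar_comp (reT T R) v z ξ hdv, dbar_eq_sum]
  have hz' : ‖prT T z‖ < R := by
    refine (norm_prT T z).trans_lt (hz.trans ?_)
    nlinarith
  let φ : EN N →+ ℂ := AddMonoidHom.mk' (f (prT T z)) (hf1 _ hz')
  have hφ : ∀ η, φ η = f (prT T z) η := fun η => rfl
  rw [← in_re T hR ξ, ← hφ]
  have e : reT T R ξ = ∑ j, reT T R ξ j • (Pi.single j (1:ℂ) : Fin T.card → ℂ) := by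
    ext i
    simp [Finset.sum_apply, Pi.single_apply]
  conv_rhs => rw [e, map_sum, map_sum]
  refine Finset.sum_congr rfl fun j _ => ?_
  rw [hv2 j _ (hre z hz), map_smul, hφ, hf2 _ hz', in_re T hR]


theorem statement11 (ρ : ℝ) (hρ0 : 0 < ρ) (hρ1 : ρ < 1) :
    ∃ C : ℝ, 1 < C ∧
      ∀ (N : ℕ), 0 < N → ∀ (R : ℝ), 0 < R → ∀ f : EN N → EN N → ℂ,
        IsForm01 1 {z : EN N | ‖z‖ < R} f →
        DbarClosed {z : EN N | ‖z‖ < R} f →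
        BddAbove (formSet0 f {z : EN N | ‖z‖ < R}) →
        ∃ u : EN N → ℂ,
          ContDiffOn ℝ 1 u {z : EN N | ‖z‖ < ρ * R} ∧
          (∀ z : EN N, ‖z‖ < ρ * R → ∀ ξ : EN N, dbar u z ξ = f z ξ) ∧
          ∀ z : EN N, ‖z‖ < ρ * R →
            ‖u z‖ ≤ R * C ^ {i : Fin N | z i ≠ 0}.ncard *
              formNorm0 f {z : EN N | ‖z‖ < R} := by
  obtain ⟨C, hC1, hC⟩ := ball_solve ρ hρ0 hρ1
  refine ⟨2 * C + 1, by linarith, ?_⟩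
  intro N _ R hR f hf hcl hbd
  set M := formNorm0 f {z : EN N | ‖z‖ < R} with hM
  have hb : ∀ z : EN N, ‖z‖ < R → ∀ ξ : EN N, ‖ξ‖ ≤ 1 → ‖f z ξ‖ ≤ M :=
    fun z hz ξ hξ => le_csSup hbd ⟨z, hz, ξ, hξ, rfl⟩
  have hM0 : 0 ≤ M := le_trans (norm_nonneg _) (hb 0 (by simpa using hR) 0 (by simp))
  have hsub := sub_solve hR hM0 hC hρ1 hf hcl hb
  choose g hg1 hg2 hg3 using hsub
  have hop : IsOpen {z : EN N | ‖z‖ < ρ * R} := isOpen_lt continuous_norm continuous_const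
  have hpm : ∀ U : Finset (Fin N), ∀ z : EN N, ‖z‖ < ρ * R → ‖prT U z‖ < ρ * R :=
    fun U z hz => (norm_prT U z).trans_lt hz
  have hpC : ∀ U : Finset (Fin N), ContDiff ℝ 1 (fun w => prT U w) :=
    fun U => ((prT U).restrictScalars ℝ).contDiff
  have hgC : ∀ T U, ContDiffOn ℝ 1 (fun z => g T (prT U z)) {z : EN N | ‖z‖ < ρ * R} :=
    fun T U => (hg1 T).comp (hpC U).contDiffOn (hpm U)
  have hgd : ∀ T U, ∀ z : EN N, ‖z‖ < ρ * R → DifferentiableAt ℝ (fun z => g T (prT U z)) z :=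
    fun T U z hz => ((hgC T U).contDiffAt (hop.mem_nhds hz)).differentiableAt (by norm_num)
  refine ⟨fun z => ∑ T : Finset (Fin N), ∑ U ∈ T.powerset,
    (-1) ^ T.card * ((-1) ^ U.card * g T (prT U z)), ?_, ?_, ?_⟩
  · refine ContDiffOn.sum fun T _ => ContDiffOn.sum fun U _ => ?_
    exact contDiffOn_const.mul (contDiffOn_const.mul (hgC T U))
  · intro z hz ξ
    have d1 : ∀ T U : Finset (Fin N), DifferentiableAt ℝ
        (fun z => ((-1:ℂ)) ^ U.card * g T (prT U z)) z :=
      fun T U => (hgd T U z hz).const_mul _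
    have d2 : ∀ T U : Finset (Fin N), DifferentiableAt ℝ
        (fun z => (-1:ℂ) ^ T.card * ((-1) ^ U.card * g T (prT U z))) z :=
      fun T U => (d1 T U).const_mul _
    rw [dbar_sum _ _ _ _ (fun T _ => DifferentiableAt.fun_sum fun U _ => d2 T U)]
    have e1 : ∀ T : Finset (Fin N), dbar (fun z => ∑ U ∈ T.powerset,
        (-1:ℂ) ^ T.card * ((-1) ^ U.card * g T (prT U z))) z ξ =
        ∑ U ∈ T.powerset, (-1) ^ T.card * ((-1) ^ U.card * f (prT U z) (prT U ξ)) := by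
      intro T
      rw [dbar_sum _ _ _ _ (fun U _ => d2 T U)]
      refine Finset.sum_congr rfl fun U hU => ?_
      rw [dbar_const_mul _ _ _ _ (d1 T U), dbar_const_mul _ _ _ _ (hgd T U z hz),
        dbar_comp (prT U) (g T) z ξ
          (((hg1 T).contDiffAt (hop.mem_nhds (hpm U z hz))).differentiableAt (by norm_num)),
        hg2 T _ (hpm U z hz), prT_prT (Finset.mem_powerset.1 hU),
        prT_prT (Finset.mem_powerset.1 hU)]
    rw [Finset.sum_congr rfl (fun T _ => e1 T)]
    rw [Finset.sum_comm' (t' := Finset.univ) (s' := fun U => Finset.univ.filter fun T => U ⊆ T)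
      (by intro T U; simp)]
    rw [Finset.sum_eq_single Finset.univ]
    · have e2 : (Finset.univ.filter fun T : Finset (Fin N) => Finset.univ ⊆ T) =
          {Finset.univ} := by
        ext T; simp [Finset.univ_subset_iff]
      have e3 : ∀ w : EN N, prT Finset.univ w = w := by
        intro w; ext i; rw [prT_apply]; simp
      rw [e2, Finset.sum_singleton, e3, e3, ← mul_assoc, ← mul_pow]
      simp
    · intro U _ hU
      obtain ⟨i, hi⟩ : ∃ i, i ∉ U := by
        by_contra hcon
        push Not at hcon
        exact hU (Finset.eq_univ_iff_forall.2 hcon)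
      apply flip_sum _ i (fun _ => (-1) ^ U.card * f (prT U z) (prT U ξ))
      · intro T hT
        rw [Finset.mem_filter] at hT ⊢
        refine ⟨Finset.mem_univ _, fun x hx => ?_⟩
        rw [Finset.mem_symmDiff, Finset.mem_singleton]
        exact Or.inl ⟨hT.2 hx, fun h => hi (h ▸ hx)⟩
      · intro T _; rfl
    · simp
  · intro z hz
    set S : Finset (Fin N) := Finset.univ.filter fun i => z i ≠ 0 with hS
    have hcard : {i : Fin N | z i ≠ 0}.ncard = S.card := by
      rw [← Set.ncard_coe_finset]; congr 1; ext i; simp [hS]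
    have hred : ∑ T : Finset (Fin N), ∑ U ∈ T.powerset,
        (-1) ^ T.card * ((-1) ^ U.card * g T (prT U z)) = ∑ T ∈ S.powerset, ∑ U ∈ T.powerset,
        (-1) ^ T.card * ((-1) ^ U.card * g T (prT U z)) := by
      symm
      apply Finset.sum_subset (Finset.subset_univ _)
      intro T _ hT
      rw [Finset.mem_powerset, Finset.not_subset] at hT
      obtain ⟨i, hiT, hiS⟩ := hT
      have hzi : z i = 0 := by simpa [hS] using hiS
      rw [← Finset.mul_sum, flip_sum _ i (fun U => g T (prT U z)), mul_zero]
      · intro U hU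
        rw [Finset.mem_powerset] at hU ⊢
        intro x hx
        rw [Finset.mem_symmDiff, Finset.mem_singleton] at hx
        rcases hx with h | h
        · exact hU h.1
        · exact h.1 ▸ hiT
      · intro U _
        have : prT (symmDiff U {i}) z = prT U z := by
          ext x
          rw [prT_apply, prT_apply]
          by_cases hx : x = i
          · subst hx; simp [hzi]
          · simp [Finset.mem_symmDiff, hx]
        simp only [this]
    beta_reduce
    rw [hred, hcard]
    calc ‖∑ T ∈ S.powerset, ∑ U ∈ T.powerset,
        (-1) ^ T.card * ((-1) ^ U.card * g T (prT U z))‖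
        ≤ ∑ T ∈ S.powerset, ∑ U ∈ T.powerset, C ^ T.card * (R * M) := by
          refine (norm_sum_le _ _).trans (Finset.sum_le_sum fun T _ => ?_)
          refine (norm_sum_le _ _).trans (Finset.sum_le_sum fun U _ => ?_)
          rw [norm_mul, norm_mul, norm_pow, norm_pow]
          simpa using hg3 T _ (hpm U z hz)
      _ = ∑ T ∈ S.powerset, ((2 * C) ^ T.card * 1 ^ (S.card - T.card)) * (R * M) := by
          refine Finset.sum_congr rfl fun T _ => ?_
          rw [Finset.sum_const, Finset.card_powerset, nsmul_eq_mul, mul_pow]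
          push_cast; ring
      _ = (2 * C + 1) ^ S.card * (R * M) := by
          rw [← Finset.sum_mul, Finset.sum_pow_mul_eq_add_pow]
      _ = _ := by ring
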